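/- arXiv:1701.03986 — 5 statements merged into one kernel-verified Lean document; each statement's English description precedes it below -/
import Mathlib

section
/- Let q be a prime power, Q = q², m ≥ 2 an odd integer, m̄ = ⌈m/2⌉ = (m+1)/2, n = Q^m − 1, e a divisor of q + 1, and n̂ = n/e. For any integer δ with 2 ≤ δ ≤ Q^m̄ + 1 = q^{m+1} + 1, define J⁺(δ) = ∪_{i=1}^{δ−1} C_{n̂+i} and J⁻(δ) = ∪_{i=1}^{δ−1} C_{n̂−qi}. Then |J⁺(δ) ∩ J⁻(δ)| = 0 if 2 ≤ δ ≤ q^m − 1; |J⁺(δ) ∩ J⁻(δ)| = u² m if u q^m ≤ δ ≤ (u+1)(q^m − 1) for some integer u with 1 ≤ u ≤ q − 1; |J⁺(δ) ∩ J⁻(δ)| = (u² + 2v + 1) m if δ = (u+1)(q^m − 1) + v + 1 for some integers u, v with 1 ≤ u ≤ q − 1 and 0 ≤ v ≤ u − 1; and |J⁺(δ) ∩ J⁻(δ)| = q² m if δ = q^{m+1} or δ = q^{m+1} + 1. -/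
open Polynomial

noncomputable section

/-- The cyclic shift of a vector: `(c₀,…,c_{n−1}) ↦ (c_{n−1},c₀,…,c_{n−2})`. -/
def cyclicShift {F : Type*} {n : ℕ} (c : Fin n → F) : Fin n → F :=
  fun i => c ⟨(i.val + (n - 1)) % n, Nat.mod_lt _ i.pos⟩

/-- A linear code (submodule of `F^n`) is cyclic if it is stable under the cyclic shift. -/
def IsCyclicCode {F : Type*} [Field F] {n : ℕ} (C : Submodule F (Fin n → F)) : Prop :=
  ∀ c ∈ C, cyclicShift c ∈ C

/-- The Hermitian dual `C^⊥H = {b : ∑ i, b i * (c i)^q = 0 for all c ∈ C}`. -/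
def hermDualSet {F : Type*} [Field F] (q : ℕ) {n : ℕ} (C : Set (Fin n → F)) :
    Set (Fin n → F) :=
  {b | ∀ c ∈ C, ∑ i, b i * (c i) ^ q = 0}

/-- A code is Hermitian LCD if `C ∩ C^⊥H = {0}`. -/
def IsHermitianLCD {F : Type*} [Field F] (q : ℕ) {n : ℕ} (C : Set (Fin n → F)) : Prop :=
  C ∩ hermDualSet q C = {0}

/-- The polynomial `c₀ + c₁ x + ⋯ + c_{n−1} x^{n−1}` associated with a vector. -/
def polyOfVec {F : Type*} [Field F] {n : ℕ} (c : Fin n → F) : Polynomial F :=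
  ∑ i : Fin n, Polynomial.C (c i) * Polynomial.X ^ (i : ℕ)

/-- The cyclic code of length `n` with generator polynomial `g` (for `g ∣ xⁿ − 1`):
vectors whose associated polynomial (of degree `< n`) is divisible by `g`. -/
def cyclicCodeOf {F : Type*} [Field F] (n : ℕ) (g : Polynomial F) :
    Submodule F (Fin n → F) where
  carrier := {c | g ∣ polyOfVec c}
  add_mem' := by
    intro a b ha hb
    have h : polyOfVec (a + b) = polyOfVec a + polyOfVec b := by
      simp [polyOfVec, add_mul, Finset.sum_add_distrib]
    simpa [Set.mem_setOf_eq, h] using dvd_add ha hb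
  zero_mem' := by simp [polyOfVec]
  smul_mem' := by
    intro r c hc
    have h : polyOfVec (r • c) = Polynomial.C r * polyOfVec c := by
      simp [polyOfVec, Finset.mul_sum, mul_assoc]
    simpa [Set.mem_setOf_eq, h] using hc.mul_left (Polynomial.C r)

/-- `f̄`: the polynomial obtained by raising every coefficient of `f` to the `q`-th power. -/
def conjPoly {F : Type*} [Field F] (q : ℕ) (f : Polynomial F) : Polynomial F :=
  f.sum fun i a => Polynomial.C (a ^ q) * Polynomial.X ^ i

/-- The reciprocal polynomial `f*(x) = f₀⁻¹ xᵗ f(1/x)`. -/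
def recipPoly {F : Type*} [Field F] (f : Polynomial F) : Polynomial F :=
  Polynomial.C (f.coeff 0)⁻¹ * f.reverse

/-- The `Q`-cyclotomic coset of `s` modulo `n`, as a subset of `{0,…,n−1} ⊆ ℕ`
(`s` is taken as an integer so that negative indices are allowed). -/
def cycCoset (Q n : ℕ) (s : ℤ) : Set ℕ :=
  {x | x < n ∧ ∃ j : ℕ, (x : ℤ) ≡ s * (Q : ℤ) ^ j [ZMOD n]}

end

/-- Exponents of `q` may be reduced modulo `2m` when working modulo `q ^ (2m) - 1`. -/
lemma pow_modEq_pow_mod (q : ℤ) (m t : ℕ) :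
    q ^ t ≡ q ^ (t % (2 * m)) [ZMOD q ^ (2 * m) - 1] := by
  have h1 : q ^ (2 * m) ≡ 1 [ZMOD q ^ (2 * m) - 1] := Int.modEq_sub _ _
  have h2 := ((h1.pow (t / (2 * m))).mul_right (q ^ (t % (2 * m))))
  rwa [← pow_mul, ← pow_add, Nat.div_add_mod, one_pow, one_mul] at h2

lemma pow_modEq_pow_of_modEq (q : ℤ) {m s t : ℕ} (h : s ≡ t [MOD 2 * m]) :
    q ^ s ≡ q ^ t [ZMOD q ^ (2 * m) - 1] := by
  have h1 := pow_modEq_pow_mod q m s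
  rw [show s % (2 * m) = t % (2 * m) from h] at h1
  exact h1.trans (pow_modEq_pow_mod q m t).symm

lemma two_mul_sq_le_pow {q : ℤ} (hq : 2 ≤ q) {m : ℕ} (hm : 3 ≤ m) : 2 * q ^ 2 ≤ q ^ m := by
  have h : q ^ 3 ≤ q ^ m := pow_le_pow_right₀ (by linarith) hm
  nlinarith [sq_nonneg q]

/-- A small odd power of `q` gives no solutions of `i + q ^ t * j ≡ 0`. -/
lemma not_dvd_add_pow_mul_of_lt {q : ℤ} (hq : 2 ≤ q) {m t : ℕ} (hm : 3 ≤ m) (ht : t + 2 ≤ m)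
    {i j : ℤ} (hi : 1 ≤ i) (hi' : i ≤ q ^ (m + 1)) (hj : 1 ≤ j) (hj' : j ≤ q ^ (m + 1)) :
    ¬ q ^ (2 * m) - 1 ∣ i + q ^ t * j := by
  intro h
  have hM := two_mul_sq_le_pow hq hm
  have hpos : 0 < q ^ t := by positivity
  have hle := Int.le_of_dvd (by positivity) h
  have ht2 : q ^ 2 * q ^ t ≤ q ^ m := by
    rw [← pow_add]; exact pow_le_pow_right₀ (by linarith) (by omega)
  rw [pow_succ] at hi' hj'
  rw [pow_mul'] at hle
  set M := q ^ m
  have h1 : q * (q ^ t * j) ≤ M * M := by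
    calc q * (q ^ t * j) ≤ q * (q ^ t * (M * q)) := by gcongr
      _ = (q ^ 2 * q ^ t) * M := by ring
      _ ≤ M * M := by gcongr
  have h2 : q * i ≤ q ^ 2 * M := by nlinarith
  have h3 : 2 * q ^ 2 * M ≤ M * M := by gcongr
  have h4 : q * (M ^ 2 - 1) ≤ q * (i + q ^ t * j) := by gcongr
  have h5 : 8 ≤ M := by nlinarith
  nlinarith [mul_nonneg (sub_nonneg.2 hq) (sq_nonneg M)]

lemma eq_of_dvd_add_pow_mul {q : ℤ} (hq : 2 ≤ q) {m t : ℕ} (hm : 3 ≤ m) (hmodd : m % 2 = 1)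
    (ht : t < 2 * m) (htodd : t % 2 = 1) {i j : ℤ} (hi : 1 ≤ i) (hi' : i ≤ q ^ (m + 1))
    (hj : 1 ≤ j) (hj' : j ≤ q ^ (m + 1)) (h : q ^ (2 * m) - 1 ∣ i + q ^ t * j) : t = m := by
  rcases lt_trichotomy t m with h1 | h1 | h1
  · exact absurd h (not_dvd_add_pow_mul_of_lt hq hm (by omega) hi hi' hj hj')
  · exact h1
  · refine absurd ?_ (not_dvd_add_pow_mul_of_lt (t := 2 * m - t) hq hm (by omega) hj hj' hi hi')
    have h2 : q ^ (2 * m) = q ^ (2 * m - t) * q ^ t := by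
      rw [← pow_add]; congr 1; omega
    have h3 : j + q ^ (2 * m - t) * i =
        q ^ (2 * m - t) * (i + q ^ t * j) - (q ^ (2 * m) - 1) * j := by
      linear_combination j * h2
    rw [h3]
    exact dvd_sub (h.mul_left _) (dvd_mul_right _ _)

/-- The only exponent, modulo `2m`, for which `i * q ^ (2a) + j * q ^ s` can vanish. -/
lemma modEq_of_dvd_mul_pow_add {q : ℤ} (hq : 2 ≤ q) {m a s : ℕ} (hm : 3 ≤ m) (hmodd : m % 2 = 1)
    (hs : s % 2 = 1) {i j : ℤ} (hi : 1 ≤ i) (hi' : i ≤ q ^ (m + 1))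
    (hj : 1 ≤ j) (hj' : j ≤ q ^ (m + 1))
    (h : q ^ (2 * m) - 1 ∣ i * q ^ (2 * a) + j * q ^ s) : s ≡ 2 * a + m [MOD 2 * m] := by
  obtain ⟨r, rfl⟩ : ∃ r, m = r + 1 := ⟨m - 1, by omega⟩
  have h1 : q ^ (2 * (r + 1)) - 1 ∣ i + q ^ ((s + 2 * (a * r)) % (2 * (r + 1))) * j := by
    refine Int.modEq_zero_iff_dvd.1 ?_
    have e1 : q ^ (2 * (a * r)) * q ^ (2 * a) ≡ 1 [ZMOD q ^ (2 * (r + 1)) - 1] := by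
      rw [← pow_add]
      refine (pow_modEq_pow_of_modEq q (t := 0) ?_).trans (by rw [pow_zero])
      rw [show 2 * (a * r) + 2 * a = 2 * (r + 1) * a by ring]
      exact (Nat.modEq_zero_iff_dvd.2 (dvd_mul_right _ _))
    have e2 := (pow_modEq_pow_mod q (r + 1) (s + 2 * (a * r))).symm.mul_right j
    have e3 := (Int.modEq_zero_iff_dvd.2 h).mul_left (q ^ (2 * (a * r)))
    calc i + q ^ ((s + 2 * (a * r)) % (2 * (r + 1))) * j
        ≡ i * (q ^ (2 * (a * r)) * q ^ (2 * a)) + q ^ (s + 2 * (a * r)) * j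
          [ZMOD q ^ (2 * (r + 1)) - 1] := by
          refine Int.ModEq.add ?_ e2
          simpa using (e1.mul_left i).symm
      _ = q ^ (2 * (a * r)) * (i * q ^ (2 * a) + j * q ^ s) := by rw [pow_add q s]; ring
      _ ≡ 0 [ZMOD q ^ (2 * (r + 1)) - 1] := by simpa using e3
  have h2 := eq_of_dvd_add_pow_mul hq hm hmodd (Nat.mod_lt _ (by omega))
    (by rw [Nat.mod_mod_of_dvd _ (dvd_mul_right _ _)]; omega) hi hi' hj hj' h1
  have h3 : s + 2 * (a * r) ≡ r + 1 [MOD 2 * (r + 1)] := by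
    rw [Nat.ModEq, h2, Nat.mod_eq_of_lt (by omega)]
  have h4 := h3.add_right (2 * a)
  rw [show s + 2 * (a * r) + 2 * a = s + 2 * (r + 1) * a by ring, add_comm (r + 1)] at h4
  simpa [Nat.ModEq] using h4

lemma dvd_add_mul_pow {q : ℤ} {m a s : ℕ} (hm : 0 < m) {i j : ℤ}
    (hs : s ≡ 2 * a + m [MOD 2 * m])
    (h : q ^ (2 * m) - 1 ∣ i * q ^ (2 * a) + j * q ^ s) :
    q ^ (2 * m) - 1 ∣ i + j * q ^ m := by
  have e := ((pow_modEq_pow_of_modEq q hs).mul_left j).add_left (i * q ^ (2 * a))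
  have h1 := (Int.modEq_zero_iff_dvd.2 h).symm.trans e
  have h2 : q ^ (2 * m) - 1 ∣ q ^ (2 * a) * (i + j * q ^ m) := by
    convert Int.modEq_zero_iff_dvd.1 h1.symm using 1
    rw [pow_add]; ring
  refine IsCoprime.dvd_of_dvd_mul_left (IsCoprime.pow_right ?_) h2
  refine ⟨-1, q ^ (2 * m - 1), ?_⟩
  rw [← pow_succ, Nat.sub_add_cancel (by omega)]
  ring

/-- The solutions of `i + j * q ^ m ≡ 0` modulo `q ^ (2m) - 1` in the relevant range. -/
lemma exists_of_dvd_add_mul_pow {q : ℤ} (hq : 2 ≤ q) {m : ℕ} (hm : 3 ≤ m) {i j : ℤ}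
    (hi : 1 ≤ i) (hi' : i ≤ q ^ (m + 1)) (hj : 1 ≤ j) (hj' : j ≤ q ^ (m + 1))
    (h : q ^ (2 * m) - 1 ∣ i + j * q ^ m) :
    ∃ A C : ℤ, 1 ≤ A ∧ A ≤ q ∧ 1 ≤ C ∧ C ≤ q ∧ i = C * q ^ m - A ∧ j = A * q ^ m - C := by
  have hM := two_mul_sq_le_pow hq hm
  rw [pow_mul'] at h
  rw [pow_succ] at hi' hj'
  set M := q ^ m
  have hMq : 4 * q ≤ M := by nlinarith
  obtain ⟨A, hA⟩ := h
  have hM1 : 0 < M ^ 2 - 1 := by nlinarith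
  have hA0 : 0 < A := by
    have : 0 < (M ^ 2 - 1) * A := by rw [← hA]; nlinarith
    exact pos_of_mul_pos_right this hM1.le
  have hAq : A < q + 1 := by
    refine lt_of_mul_lt_mul_left (a := M ^ 2 - 1) ?_ hM1.le
    rw [← hA]
    nlinarith
  have hC : i = (A * M - j) * M - A := by linear_combination hA
  have hC0 : 0 < A * M - j := by
    have : 0 < (A * M - j) * M := by linarith
    exact pos_of_mul_pos_left this (by linarith)
  have hCq : A * M - j < q + 1 := by
    refine lt_of_mul_lt_mul_right (a := M) ?_ (by linarith)
    nlinarith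
  exact ⟨A, A * M - j, hA0, by linarith, hC0, by linarith, hC, by ring⟩

lemma mem_iUnion_cycCoset {ι : Finset ℕ} {Q n : ℕ} {f : ℕ → ℤ} {nh : ℤ}
    (hnh : nh * Q ≡ nh [ZMOD n]) {x : ℕ} :
    x ∈ ⋃ i ∈ ι, cycCoset Q n (nh + f i) ↔
      x < n ∧ ∃ i ∈ ι, ∃ a : ℕ, (x : ℤ) ≡ nh + f i * (Q : ℤ) ^ a [ZMOD n] := by
  have key : ∀ a : ℕ, nh * (Q : ℤ) ^ a ≡ nh [ZMOD n] := by
    intro a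
    induction a with
    | zero => simp
    | succ a ih => rw [pow_succ, ← mul_assoc]; exact (ih.mul_right _).trans hnh
  have key2 : ∀ i a, (nh + f i) * (Q : ℤ) ^ a ≡ nh + f i * (Q : ℤ) ^ a [ZMOD n] := by
    intro i a; rw [add_mul]; exact (key a).add_right _
  simp only [Set.mem_iUnion, cycCoset, Set.mem_ofPred_eq]
  constructor
  · rintro ⟨i, hi, hx, a, ha⟩
    exact ⟨hx, i, hi, a, ha.trans (key2 i a)⟩
  · rintro ⟨hx, i, hi, a, ha⟩
    exact ⟨i, hi, hx, a, ha.trans (key2 i a).symm⟩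

lemma eq_and_eq_of_mul_sub_eq {q M A C A' C' : ℤ} (hA : 1 ≤ A) (hAq : A ≤ q) (hA' : 1 ≤ A')
    (hAq' : A' ≤ q) (hM : q ≤ M) (h : C * M - A = C' * M - A') : C = C' ∧ A = A' := by
  have hC : C = C' := by
    rcases lt_trichotomy C C' with h1 | h1 | h1
    · nlinarith
    · exact h1
    · nlinarith
  subst hC
  exact ⟨rfl, by linarith⟩

/-- Pairs `(A, C)` parametrising the solutions with both coordinates below `δ`. -/
def solutionPairs (q M δ : ℕ) : Finset (ℕ × ℕ) :=
  (Finset.Icc 1 q ×ˢ Finset.Icc 1 q).filter fun p => p.2 * M < δ + p.1 ∧ p.1 * M < δ + p.2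

lemma mem_solutionPairs {q M δ A C : ℕ} : (A, C) ∈ solutionPairs q M δ ↔
    ((1 ≤ A ∧ A ≤ q) ∧ 1 ≤ C ∧ C ≤ q) ∧ C * M < δ + A ∧ A * M < δ + C := by
  simp [solutionPairs]

lemma card_solutionPairs_of_le {q M δ : ℕ} (hM : 0 < M) (h : δ ≤ M - 1) :
    (solutionPairs q M δ).card = 0 := by
  rw [Finset.card_eq_zero, Finset.eq_empty_iff_forall_notMem]
  rintro ⟨A, C⟩ hx
  obtain ⟨⟨⟨hA, -⟩, hC, -⟩, h1, h2⟩ := mem_solutionPairs.1 hx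
  obtain ⟨K, rfl⟩ : ∃ K, M = K + 1 := ⟨M - 1, by omega⟩
  simp only [Nat.add_sub_cancel] at h
  rcases le_total A C with h3 | h3 <;> nlinarith

lemma card_solutionPairs_of_mem_Icc {q M δ u : ℕ} (hM : 0 < M) (hu : u ≤ q)
    (h : u * M ≤ δ) (h' : δ ≤ (u + 1) * (M - 1)) :
    (solutionPairs q M δ).card = u ^ 2 := by
  have : solutionPairs q M δ = Finset.Icc 1 u ×ˢ Finset.Icc 1 u := by
    ext ⟨A, C⟩
    rw [mem_solutionPairs, Finset.mem_product, Finset.mem_Icc, Finset.mem_Icc]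
    obtain ⟨K, rfl⟩ : ∃ K, M = K + 1 := ⟨M - 1, by omega⟩
    simp only [Nat.add_sub_cancel] at h'
    constructor
    · rintro ⟨⟨⟨hA, -⟩, hC, -⟩, h1, h2⟩
      rcases le_total A C with h3 | h3
      · have : C ≤ u := by
          by_contra! h4
          have : (u + 1) * K ≤ C * K := Nat.mul_le_mul_right _ h4
          nlinarith
        omega
      · have : A ≤ u := by
          by_contra! h4
          have : (u + 1) * K ≤ A * K := Nat.mul_le_mul_right _ h4
          nlinarith
        omega
    · rintro ⟨⟨hA, hA'⟩, hC, hC'⟩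
      have h1 := Nat.mul_le_mul_right (K + 1) hA'
      have h2 := Nat.mul_le_mul_right (K + 1) hC'
      dsimp only at *
      refine ⟨⟨⟨hA, ?_⟩, hC, ?_⟩, ?_, ?_⟩ <;> linarith
  rw [this, Finset.card_product, Nat.card_Icc]
  simp [sq]

lemma card_solutionPairs_of_eq {q M δ u v : ℕ} (hu : u + 1 ≤ q) (hM : q + 1 < M) (hv : v + 1 ≤ u)
    (h : δ = (u + 1) * (M - 1) + v + 1) :
    (solutionPairs q M δ).card = u ^ 2 + 2 * v + 1 := by
  have : solutionPairs q M δ = (Finset.Icc 1 u ×ˢ Finset.Icc 1 u) ∪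
      ((Finset.Icc (u + 1 - v) u ×ˢ {u + 1}) ∪ ({u + 1} ×ˢ Finset.Icc (u + 1 - v) (u + 1))) := by
    ext ⟨A, C⟩
    simp only [mem_solutionPairs, Finset.mem_union, Finset.mem_product, Finset.mem_Icc,
      Finset.mem_singleton]
    obtain ⟨K, rfl⟩ : ∃ K, M = K + 1 := ⟨M - 1, by omega⟩
    simp only [Nat.add_sub_cancel] at h
    subst h
    constructor
    · rintro ⟨⟨⟨hA, -⟩, hC, -⟩, h1, h2⟩
      have hle : ∀ {A C : ℕ}, A ≤ C → C * (K + 1) < (u + 1) * K + v + 1 + A →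
          C ≤ u ∨ C = u + 1 ∧ u + 1 ≤ A + v := by
        intro A C h3 h1
        rcases lt_trichotomy C (u + 1) with h4 | rfl | h4
        · omega
        · refine Or.inr ⟨rfl, ?_⟩
          nlinarith
        · exfalso
          have : (u + 2) * K ≤ C * K := Nat.mul_le_mul_right _ h4
          nlinarith
      rcases le_total A C with h3 | h3
      · have := hle h3 h1
        omega
      · have := hle h3 h2
        omega
    · have small : ∀ {C A : ℕ}, 1 ≤ A → C ≤ u → C * (K + 1) < (u + 1) * K + v + 1 + A := by
        intro C A hA hC
        have := Nat.mul_le_mul_right (K + 1) hC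
        nlinarith
      have big : ∀ {A : ℕ}, u + 1 - v ≤ A →
          (u + 1) * (K + 1) < (u + 1) * K + v + 1 + A := by
        intro A hA
        have : u + 1 ≤ A + v := by omega
        nlinarith
      rintro (⟨⟨hA, hA'⟩, hC, hC'⟩ | ⟨⟨hA, hA'⟩, rfl⟩ | ⟨rfl, hC, hC'⟩)
      · exact ⟨by omega, small hA hC', small hC hA'⟩
      · exact ⟨by omega, big hA, small (by omega) hA'⟩
      · refine ⟨by omega, ?_, big hC⟩
        rcases Nat.lt_or_ge C (u + 1) with h1 | h1
        · exact small (by omega) (by omega)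
        · obtain rfl : C = u + 1 := by omega
          exact big hC
  rw [this, Finset.card_union_of_disjoint, Finset.card_union_of_disjoint]
  · simp only [Finset.card_product, Nat.card_Icc, Finset.card_singleton, add_tsub_cancel_right,
      mul_one, one_mul, sq]
    omega
  · rw [Finset.disjoint_left]
    rintro ⟨A, C⟩
    simp only [Finset.mem_product, Finset.mem_Icc, Finset.mem_singleton]
    omega
  · rw [Finset.disjoint_left]
    rintro ⟨A, C⟩
    simp only [Finset.mem_union, Finset.mem_product, Finset.mem_Icc, Finset.mem_singleton]
    omega

lemma card_solutionPairs_of_ge {q M δ : ℕ} (h : q * M ≤ δ) :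
    (solutionPairs q M δ).card = q ^ 2 := by
  have : solutionPairs q M δ = Finset.Icc 1 q ×ˢ Finset.Icc 1 q := by
    refine Finset.filter_true_of_mem ?_
    rintro ⟨A, C⟩ hx
    obtain ⟨⟨hA, hA'⟩, hC, hC'⟩ : (1 ≤ A ∧ A ≤ q) ∧ 1 ≤ C ∧ C ≤ q := by simpa using hx
    have h1 := Nat.mul_le_mul_right M hA'
    have h2 := Nat.mul_le_mul_right M hC'
    constructor <;> linarith
  rw [this, Finset.card_product, Nat.card_Icc]
  simp [sq]

/-- The intersection of the two unions of cosets consists of `m` translates for every solution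
pair. -/
lemma ncard_iUnion_cycCoset_inter {q m n δ : ℕ} {nh : ℤ} (hq : 2 ≤ q) (hm : 3 ≤ m)
    (hmodd : m % 2 = 1) (hn : n = (q ^ 2) ^ m - 1) (hδ : δ ≤ q ^ (m + 1) + 1)
    (hnh : nh * (q ^ 2 : ℕ) ≡ nh [ZMOD n]) :
    ((⋃ i ∈ Finset.Icc 1 (δ - 1), cycCoset (q ^ 2) n (nh + i)) ∩
      (⋃ i ∈ Finset.Icc 1 (δ - 1), cycCoset (q ^ 2) n (nh - q * i))).ncard =
      (solutionPairs q (q ^ m) δ).card * m := by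
  have hqz : (2 : ℤ) ≤ q := by exact_mod_cast hq
  have hnz : (n : ℤ) = (q : ℤ) ^ (2 * m) - 1 := by
    rw [hn, Nat.cast_sub (Nat.one_le_pow _ _ (by positivity))]
    push_cast
    rw [pow_mul]
  have hM := two_mul_sq_le_pow hqz hm
  have hMq : 4 * (q : ℤ) ≤ (q : ℤ) ^ m := by nlinarith
  have hn_pos : (0 : ℤ) < n := by
    rw [hnz, pow_mul']; nlinarith
  let f : (ℕ × ℕ) × ℕ → ℕ := fun p =>
    ((nh + ((p.1.2 : ℤ) * q ^ m - p.1.1) * (q : ℤ) ^ (2 * p.2)) % n).toNat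
  have hf_cast : ∀ p, (f p : ℤ) =
      (nh + ((p.1.2 : ℤ) * q ^ m - p.1.1) * (q : ℤ) ^ (2 * p.2)) % n := fun p =>
    Int.toNat_of_nonneg (Int.emod_nonneg _ hn_pos.ne')
  have hf_mod : ∀ p, (f p : ℤ) ≡
      nh + ((p.1.2 : ℤ) * q ^ m - p.1.1) * (q : ℤ) ^ (2 * p.2) [ZMOD n] := fun p => by
    rw [hf_cast]; exact Int.mod_modEq _ _
  have hf_lt : ∀ p, f p < n := fun p => by
    have := Int.emod_lt_of_pos
      (nh + ((p.1.2 : ℤ) * q ^ m - p.1.1) * (q : ℤ) ^ (2 * p.2)) hn_pos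
    rw [← hf_cast] at this
    exact_mod_cast this
  have hdz : (δ : ℤ) ≤ (q : ℤ) ^ (m + 1) + 1 := by exact_mod_cast hδ
  have hsol : ∀ {A C : ℕ}, (A, C) ∈ solutionPairs q (q ^ m) δ →
      1 ≤ (C : ℤ) * q ^ m - A ∧ (C : ℤ) * q ^ m - A < δ := by
    intro A C h
    obtain ⟨⟨⟨hA, hA'⟩, hC, hC'⟩, h1, h2⟩ := mem_solutionPairs.1 h
    zify at *
    constructor <;> nlinarith
  have hswap : ∀ {A C : ℕ}, (A, C) ∈ solutionPairs q (q ^ m) δ →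
      (C, A) ∈ solutionPairs q (q ^ m) δ := by
    intro A C h
    rw [mem_solutionPairs] at h ⊢
    tauto
  have hrel : ∀ A C : ℤ, C * (q : ℤ) ^ m - A ≡ -((A * (q : ℤ) ^ m - C) * (q : ℤ) ^ m)
      [ZMOD n] := by
    intro A C
    rw [Int.modEq_iff_dvd, hnz]
    exact ⟨-A, by rw [pow_mul']; ring⟩
  have himage : ((⋃ i ∈ Finset.Icc 1 (δ - 1), cycCoset (q ^ 2) n (nh + i)) ∩
      (⋃ i ∈ Finset.Icc 1 (δ - 1), cycCoset (q ^ 2) n (nh - q * i))) =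
      f '' (solutionPairs q (q ^ m) δ ×ˢ Finset.range m : Finset _) := by
    ext x
    simp only [sub_eq_add_neg]
    rw [Set.mem_inter_iff, mem_iUnion_cycCoset (f := fun i => (i : ℤ)) hnh,
      mem_iUnion_cycCoset (f := fun i => -((q : ℤ) * i)) hnh]
    simp only [Nat.cast_pow, ← pow_mul]
    constructor
    · rintro ⟨⟨hx, i, hi, a, ha⟩, -, j, hj, b, hb⟩
      rw [Finset.mem_Icc] at hi hj
      have hi1 : (1 : ℤ) ≤ i := by exact_mod_cast hi.1
      have hj1 : (1 : ℤ) ≤ j := by exact_mod_cast hj.1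
      have hi2 : (i : ℤ) < δ := by have := hi.2; omega
      have hj2 : (j : ℤ) < δ := by have := hj.2; omega
      have hd : (q : ℤ) ^ (2 * m) - 1 ∣ i * (q : ℤ) ^ (2 * a) + j * (q : ℤ) ^ (2 * b + 1) := by
        rw [← hnz]
        convert Int.modEq_iff_dvd.1 (hb.symm.trans ha) using 1
        ring
      have hmod := modEq_of_dvd_mul_pow_add hqz hm hmodd (by omega) hi1 (by linarith) hj1
        (by linarith) hd
      obtain ⟨A, C, hA, hA', hC, hC', hiA, hjA⟩ := exists_of_dvd_add_mul_pow hqz hm hi1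
        (by linarith) hj1 (by linarith) (dvd_add_mul_pow (by omega) hmod hd)
      lift A to ℕ using by linarith
      lift C to ℕ using by linarith
      refine ⟨((A, C), a % m), ?_, ?_⟩
      · rw [Finset.mem_coe, Finset.mem_product, mem_solutionPairs, Finset.mem_range]
        refine ⟨?_, Nat.mod_lt _ (by omega)⟩
        zify
        refine ⟨⟨⟨hA, hA'⟩, hC, hC'⟩, by linarith, by linarith⟩
      · have h1 := hf_mod ((A, C), a % m)
        dsimp only at h1
        rw [← hiA] at h1
        have h2 : (q : ℤ) ^ (2 * (a % m)) ≡ (q : ℤ) ^ (2 * a) [ZMOD n] := by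
          rw [hnz]
          exact pow_modEq_pow_of_modEq _ ((Nat.mod_modEq a m).mul_left' 2)
        have h3 := (h1.trans ((h2.mul_left _).add_left nh)).trans ha.symm
        exact (Int.natCast_modEq_iff.1 h3).eq_of_lt_of_lt (hf_lt _) hx
    · rintro ⟨⟨⟨A, C⟩, k⟩, hp, rfl⟩
      rw [Finset.mem_coe, Finset.mem_product] at hp
      obtain ⟨hp, -⟩ := hp
      have h1 := hsol hp
      have h2 := hsol (hswap hp)
      have h3 := hf_mod ((A, C), k)
      have h4 := hrel A C
      dsimp only at h3
      obtain ⟨i, hi⟩ : ∃ i : ℕ, (i : ℤ) = (C : ℤ) * q ^ m - A :=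
        ⟨_, Int.toNat_of_nonneg (by linarith)⟩
      obtain ⟨j, hj⟩ : ∃ j : ℕ, (j : ℤ) = (A : ℤ) * q ^ m - C :=
        ⟨_, Int.toNat_of_nonneg (by linarith)⟩
      rw [← hi] at h1 h3 h4
      rw [← hj] at h2 h4
      refine ⟨⟨hf_lt _, i, Finset.mem_Icc.2 (by omega), k, h3⟩,
        hf_lt _, j, Finset.mem_Icc.2 (by omega), (m / 2 + k), ?_⟩
      convert h3.trans ((h4.mul_right _).add_left nh) using 1
      have h5 : (q : ℤ) ^ m = q ^ (2 * (m / 2)) * q := by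
        rw [← pow_succ]; congr 1; omega
      rw [h5, mul_add, pow_add]
      ring
  have hinj : Set.InjOn f (solutionPairs q (q ^ m) δ ×ˢ Finset.range m : Finset _) := by
    rintro ⟨⟨A, C⟩, k⟩ hp ⟨⟨A', C'⟩, k'⟩ hp' hff
    rw [Finset.mem_coe, Finset.mem_product, Finset.mem_range] at hp hp'
    obtain ⟨hp, hk⟩ := hp
    obtain ⟨hp', hk'⟩ := hp'
    dsimp only at hp hp' hk hk'
    have h1 := hsol hp
    have h1' := hsol hp'
    have h2' := hsol (hswap hp')
    have h3 := hf_mod ((A, C), k)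
    rw [hff] at h3
    have h4 := (h3.symm.trans (hf_mod ((A', C'), k'))).add_left_cancel' nh
    dsimp only at h4
    have hd : (q : ℤ) ^ (2 * m) - 1 ∣ ((C : ℤ) * q ^ m - A) * (q : ℤ) ^ (2 * k) +
        ((A' : ℤ) * q ^ m - C') * (q : ℤ) ^ (m + 2 * k') := by
      rw [← hnz]
      convert Int.modEq_iff_dvd.1 (h4.trans ((hrel A' C').mul_right _)).symm using 1
      rw [pow_add]
      ring
    have hmod := modEq_of_dvd_mul_pow_add hqz hm hmodd (by omega) h1.1 (by linarith) h2'.1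
      (by linarith) hd
    have hkk : k = k' := by
      have h5 : 2 * k' ≡ 2 * k [MOD 2 * m] := by
        rw [add_comm (2 * k)] at hmod
        exact hmod.add_left_cancel' m
      have h6 := h5.eq_of_lt_of_lt (by omega) (by omega)
      omega
    subst hkk
    have h5 := dvd_add_mul_pow (by omega) hmod hd
    rw [← hnz] at h5
    have h6 : (C : ℤ) * q ^ m - A ≡ (C' : ℤ) * q ^ m - A' [ZMOD n] := by
      refine Int.ModEq.trans ?_ (hrel A' C').symm
      rw [Int.modEq_iff_dvd]
      obtain ⟨c, hc⟩ := h5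
      exact ⟨-c, by linear_combination -hc⟩
    have hlt : ((q : ℤ) ^ (m + 1)) < n := by
      rw [hnz, pow_mul', pow_succ]; nlinarith
    have h7 : (C : ℤ) * q ^ m - A = (C' : ℤ) * q ^ m - A' := by
      have := h6.eq
      rwa [Int.emod_eq_of_lt (by linarith) (by linarith),
        Int.emod_eq_of_lt (by linarith) (by linarith)] at this
    obtain ⟨⟨⟨hA1, hA2⟩, -, -⟩, -⟩ := mem_solutionPairs.1 hp
    obtain ⟨⟨⟨hA1', hA2'⟩, -, -⟩, -⟩ := mem_solutionPairs.1 hp'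
    zify at hA1 hA2 hA1' hA2'
    obtain ⟨hC, hA⟩ := eq_and_eq_of_mul_sub_eq hA1 hA2 hA1' hA2' (by linarith) h7
    rw [Nat.cast_inj.1 hC, Nat.cast_inj.1 hA]
  rw [himage, hinj.ncard_image, Set.ncard_coe_finset, Finset.card_product,
    Finset.card_range]

/-- For odd `m ≥ 2`, `n = Qᵐ − 1`, `n̂ = n/e`, and `2 ≤ δ ≤ q^{m+1} + 1`,
the cardinality of `J⁺(δ) ∩ J⁻(δ)` by cases. -/
theorem stmt9 {q Q m e n nh δ : ℕ} (hq : IsPrimePow q) (hQ : Q = q ^ 2) (hm : 2 ≤ m)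
    (hmodd : m % 2 = 1) (he : e ∣ q + 1) (he0 : 0 < e) (hn : n = Q ^ m - 1)
    (hnh : nh = n / e) (hδ1 : 2 ≤ δ) (hδ2 : δ ≤ q ^ (m + 1) + 1) :
    (δ ≤ q ^ m - 1 →
      ((⋃ i ∈ Finset.Icc 1 (δ - 1), cycCoset Q n ((nh : ℤ) + i)) ∩
        (⋃ i ∈ Finset.Icc 1 (δ - 1), cycCoset Q n ((nh : ℤ) - q * i))).ncard = 0) ∧
    (∀ u : ℕ, 1 ≤ u → u ≤ q - 1 → u * q ^ m ≤ δ → δ ≤ (u + 1) * (q ^ m - 1) →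
      ((⋃ i ∈ Finset.Icc 1 (δ - 1), cycCoset Q n ((nh : ℤ) + i)) ∩
        (⋃ i ∈ Finset.Icc 1 (δ - 1), cycCoset Q n ((nh : ℤ) - q * i))).ncard = u ^ 2 * m) ∧
    (∀ u v : ℕ, 1 ≤ u → u ≤ q - 1 → v ≤ u - 1 → δ = (u + 1) * (q ^ m - 1) + v + 1 →
      ((⋃ i ∈ Finset.Icc 1 (δ - 1), cycCoset Q n ((nh : ℤ) + i)) ∩
        (⋃ i ∈ Finset.Icc 1 (δ - 1), cycCoset Q n ((nh : ℤ) - q * i))).ncard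
          = (u ^ 2 + 2 * v + 1) * m) ∧
    (δ = q ^ (m + 1) ∨ δ = q ^ (m + 1) + 1 →
      ((⋃ i ∈ Finset.Icc 1 (δ - 1), cycCoset Q n ((nh : ℤ) + i)) ∩
        (⋃ i ∈ Finset.Icc 1 (δ - 1), cycCoset Q n ((nh : ℤ) - q * i))).ncard = q ^ 2 * m) := by
  subst hQ
  have hq2 : 2 ≤ q := hq.two_le
  have hm3 : 3 ≤ m := by omega
  have hM : q + 1 < q ^ m := by
    have h := two_mul_sq_le_pow (q := q) (by exact_mod_cast hq2) hm3
    norm_cast at h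
    nlinarith
  have hen : e ∣ n := by
    have h1 : q ^ 2 - 1 ∣ n := by
      rw [hn]; simpa using Nat.sub_dvd_pow_sub_pow (q ^ 2) 1 m
    refine he.trans (Dvd.dvd.trans ?_ h1)
    simpa using (Dvd.intro _ (Nat.sq_sub_sq q 1).symm)
  have hnhQ : (nh : ℤ) * (q ^ 2 : ℕ) ≡ nh [ZMOD n] := by
    obtain ⟨c, hc⟩ := he
    have h1 : e * nh = n := by rw [hnh]; exact Nat.mul_div_cancel' hen
    refine (Int.modEq_iff_dvd.2 ⟨c * (q - 1), ?_⟩).symm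
    have hc' : (q : ℤ) + 1 = e * c := by exact_mod_cast hc
    rw [← h1]
    push_cast
    linear_combination (nh : ℤ) * (q - 1) * hc'
  rw [ncard_iUnion_cycCoset_inter hq2 hm3 hmodd hn hδ2 hnhQ]
  refine ⟨fun h => ?_, fun u _ hu h h' => ?_, fun u v hu1 hu hv h => ?_, fun h => ?_⟩
  · rw [card_solutionPairs_of_le (by omega) h, zero_mul]
  · rw [card_solutionPairs_of_mem_Icc (by omega) (by omega) h h']
  · rw [card_solutionPairs_of_eq (by omega) hM (by omega) h]
  · rw [card_solutionPairs_of_ge]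
    rw [← pow_succ']
    omega
end

section
/- Let q be a prime power, Q = q², m ≥ 2 an even integer, n = Q^m − 1, e a divisor of q + 1, and n̂ = n/e. For any integer δ with 2 ≤ δ ≤ q^m + 1, define J⁺(δ) = ∪_{i=1}^{δ−1} C_{n̂+i} and J⁻(δ) = ∪_{i=1}^{δ−1} C_{n̂−qi}. Then J⁺(δ) ∩ J⁻(δ) = ∅. -/
open Polynomial

lemma not_dvd_add_mul_pow {q m k a b : ℕ} (hq : 2 ≤ q) (hm : 2 ≤ m) (hk : k < m)
    (ha : 0 < a) (ha' : a ≤ q ^ m) (hb : b ≤ q ^ m) : ¬ q ^ (2 * m) - 1 ∣ a + b * q ^ k := by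
  intro h
  have hle := Nat.le_of_dvd (by omega) h
  have h1 : b * q ^ k ≤ q ^ (2 * m - 1) := calc
    b * q ^ k ≤ q ^ m * q ^ (m - 1) :=
      Nat.mul_le_mul hb (Nat.pow_le_pow_right (by omega) (by omega))
    _ = q ^ (2 * m - 1) := by rw [← pow_add]; congr 1; omega
  have h2 : 2 * q ^ (2 * m - 1) ≤ q ^ (2 * m) := calc
    2 * q ^ (2 * m - 1) ≤ q * q ^ (2 * m - 1) := Nat.mul_le_mul_right _ hq
    _ = q ^ (2 * m) := by rw [← pow_succ']; congr 1; omega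
  have h3 : 2 * q ^ m ≤ q ^ (2 * m - 1) := calc
    2 * q ^ m ≤ q * q ^ m := Nat.mul_le_mul_right _ hq
    _ = q ^ (m + 1) := by rw [← pow_succ']
    _ ≤ q ^ (2 * m - 1) := Nat.pow_le_pow_right (by omega) (by omega)
  have h4 : 2 ^ 2 ≤ q ^ m :=
    (Nat.pow_le_pow_left hq 2).trans (Nat.pow_le_pow_right (by omega) hm)
  omega

lemma pow_modEq_pow_mod_s10 {q N : ℕ} (hq : 0 < q) (k : ℕ) :
    q ^ k ≡ q ^ (k % N) [MOD q ^ N - 1] := by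
  have h1 : q ^ N ≡ 1 [MOD q ^ N - 1] :=
    ((Nat.modEq_iff_dvd' (Nat.one_le_pow _ _ hq)).2 dvd_rfl).symm
  calc q ^ k = (q ^ N) ^ (k / N) * q ^ (k % N) := by rw [← pow_mul, ← pow_add, Nat.div_add_mod]
    _ ≡ 1 ^ (k / N) * q ^ (k % N) [MOD q ^ N - 1] := (h1.pow _).mul_right _
    _ = q ^ (k % N) := by simp

lemma dvd_mul_pow_add_mul_pow_shift {q N A B A' B' a b : ℕ} (hq : 0 < q) (t : ℕ)
    (hA : (A + t) % N = A' % N) (hB : (B + t) % N = B' % N)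
    (h : q ^ N - 1 ∣ a * q ^ A + b * q ^ B) : q ^ N - 1 ∣ a * q ^ A' + b * q ^ B' := by
  have shift : ∀ {C C' : ℕ}, (C + t) % N = C' % N → q ^ (C + t) ≡ q ^ C' [MOD q ^ N - 1] :=
    fun {C C'} hC => (pow_modEq_pow_mod_s10 hq _).trans (hC ▸ (pow_modEq_pow_mod_s10 hq _).symm)
  have e : (a * q ^ A + b * q ^ B) * q ^ t = a * q ^ (A + t) + b * q ^ (B + t) := by ring
  have h' := h.mul_right (q ^ t)
  rw [e] at h'
  exact (Nat.ModEq.dvd_iff (((shift hA).mul_left a).add ((shift hB).mul_left b)) dvd_rfl).1 h'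

lemma not_dvd_mul_pow_add_mul_pow {q m A B a b : ℕ} (hq : 2 ≤ q) (hm : 2 ≤ m)
    (hmeven : m % 2 = 0) (hAB : A % 2 ≠ B % 2) (ha : 0 < a) (ha' : a ≤ q ^ m) (hb : 0 < b)
    (hb' : b ≤ q ^ m) : ¬ q ^ (2 * m) - 1 ∣ a * q ^ A + b * q ^ B := by
  intro h
  obtain ⟨k, hk⟩ : ∃ k, k = (B + (2 * m - 1) * A) % (2 * m) := ⟨_, rfl⟩
  have hk2m : k < 2 * m := hk ▸ Nat.mod_lt _ (by omega)
  have hkodd : k % 2 = 1 := by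
    rw [hk, Nat.mod_mod_of_dvd _ (dvd_mul_right 2 m), Nat.add_mod, Nat.mul_mod,
      show (2 * m - 1) % 2 = 1 by omega]
    omega
  have h1 : q ^ (2 * m) - 1 ∣ a * q ^ 0 + b * q ^ k := by
    refine dvd_mul_pow_add_mul_pow_shift (by omega) ((2 * m - 1) * A) ?_ ?_ h
    · have : A + (2 * m - 1) * A = 2 * m * A := by
        obtain ⟨c, hc⟩ : ∃ c, 2 * m = c + 1 := ⟨2 * m - 1, by omega⟩
        rw [hc, Nat.add_sub_cancel]; ring
      simp [this]
    · simp [hk]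
  rcases Nat.lt_or_ge k m with hkm | hkm
  · exact not_dvd_add_mul_pow hq hm hkm ha ha' hb' (by simpa using h1)
  · have h2 : q ^ (2 * m) - 1 ∣ a * q ^ (2 * m - k) + b * q ^ 0 := by
      refine dvd_mul_pow_add_mul_pow_shift (by omega) (2 * m - k) (by simp) ?_ h1
      simp [Nat.add_sub_cancel' hk2m.le]
    exact not_dvd_add_mul_pow hq hm (k := 2 * m - k) (by omega) hb hb' ha'
      (by simpa [add_comm] using h2)

/-- For even `m ≥ 2`, `n = Qᵐ − 1`, `n̂ = n/e`, and `2 ≤ δ ≤ qᵐ + 1`,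
`J⁺(δ) ∩ J⁻(δ) = ∅`. -/
theorem stmt10 {q Q m e n nh δ : ℕ} (hq : IsPrimePow q) (hQ : Q = q ^ 2) (hm : 2 ≤ m)
    (hmeven : m % 2 = 0) (he : e ∣ q + 1) (he0 : 0 < e) (hn : n = Q ^ m - 1)
    (hnh : nh = n / e) (hδ1 : 2 ≤ δ) (hδ2 : δ ≤ q ^ m + 1) :
    (⋃ i ∈ Finset.Icc 1 (δ - 1), cycCoset Q n ((nh : ℤ) + i)) ∩
      (⋃ i ∈ Finset.Icc 1 (δ - 1), cycCoset Q n ((nh : ℤ) - q * i)) = ∅ := by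
  have hq2 : 2 ≤ q := hq.two_le
  have hnq : n = q ^ (2 * m) - 1 := by rw [hn, hQ, pow_mul]
  have hQ1 : 1 ≤ Q := hQ ▸ Nat.one_le_pow _ _ (by omega)
  have heQ : e ∣ Q - 1 := by
    have : Q - 1 = (q + 1) * (q - 1) := by rw [hQ, ← Nat.sq_sub_sq]
    exact this ▸ he.mul_right _
  have hen : e ∣ n := hn ▸ heQ.trans (by simpa using Nat.sub_dvd_pow_sub_pow Q 1 m)
  have hnhe : (n : ℤ) = nh * e := by rw [hnh]; exact_mod_cast (Nat.div_mul_cancel hen).symm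
  have hfix : ∀ j : ℕ, (nh : ℤ) * (Q : ℤ) ^ j ≡ nh [ZMOD n] := by
    intro j
    refine (Int.modEq_iff_dvd.2 ?_).symm
    have h1 : (e : ℤ) ∣ (Q : ℤ) ^ j - 1 := by
      have h2 : (e : ℤ) ∣ (Q : ℤ) - 1 := by
        have := Int.natCast_dvd_natCast.2 heQ
        rwa [Nat.cast_sub hQ1, Nat.cast_one] at this
      exact h2.trans (by simpa using sub_dvd_pow_sub_pow (Q : ℤ) 1 j)
    rw [hnhe, ← mul_sub_one]
    exact mul_dvd_mul_left _ h1
  ext x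
  simp only [Set.mem_inter_iff, Set.mem_iUnion, Finset.mem_Icc, cycCoset, Set.mem_ofPred_eq,
    Set.mem_empty_iff_false, iff_false, not_and]
  rintro ⟨i, ⟨hi1, hi2⟩, -, a, ha⟩ ⟨i', ⟨hi1', hi2'⟩, -, b, hb⟩
  refine not_dvd_mul_pow_add_mul_pow hq2 hm hmeven (A := 2 * a) (B := 2 * b + 1) (by omega)
    hi1 (by omega) hi1' (by omega) ?_
  rw [← hnq, ← Int.natCast_dvd_natCast]
  have h := (hb.symm.trans ha).dvd.add ((hfix a).trans (hfix b).symm).dvd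
  refine h.trans (dvd_of_eq ?_)
  rw [hQ]
  push_cast
  ring
end

section
/- Let q be a prime power, Q = q², m ≥ 2 an odd integer, m̄ = (m+1)/2, n = Q^m − 1, e a divisor of q + 1, n̂ = n/e, and let 2 ≤ δ ≤ Q^m̄ + 1 = q^{m+1} + 1. Let α be a generator of GF(Q^m)*, m_i(x) the minimal polynomial of α^i over GF(Q) (indices modulo n), and let C be the cyclic code of length n over GF(Q) with generator polynomial g(x) = (x − α^{n̂}) · g_{(n,δ,n̂+1)}(x) · lcm(m_{n̂−q(δ−1)}(x), m_{n̂−q(δ−2)}(x), …, m_{n̂−q}(x)). Then C is a Hermitian LCD code over GF(Q) of length n = Q^m − 1, its minimum distance d satisfies d ≥ δ + 1 + ⌊(δ−1)/q⌋, and its dimension k equals: Q^m − 2 − 2(δ − 1 − ⌊(δ−1)/Q⌋)m, if 2 ≤ δ ≤ q^m − 1; Q^m − 2 − 2(δ − 1 − ⌊(δ−1)/Q⌋)m + u² m, if u q^m ≤ δ ≤ (u+1)(q^m − 1) for some 1 ≤ u ≤ q − 1; Q^m − 2 − 2(δ − 1 − ⌊(δ−1)/Q⌋)m + (u² + 2v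 + 1)m, if δ = (u+1)(q^m − 1) + v + 1 for some 1 ≤ u ≤ q − 1 and 0 ≤ v ≤ u − 1; Q^m − 2 − 2(δ − 1 − ⌊(δ−1)/Q⌋)m + q² m, if δ = q^{m+1} or δ = q^{m+1} + 1. -/
open Polynomial

lemma dvd_of_mul_pow_modEq {q m i j k : ℕ} (hq : 2 ≤ q) (hm : 3 ≤ m)
    (hi1 : i < q ^ (m + 1)) (hj1 : j < q ^ (m + 1))
    (hk0 : k ≠ 0) (hk : 2 * k + 1 ≤ m) (h : i * (q ^ 2) ^ k ≡ j [MOD q ^ (2 * m) - 1]) :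
    q ^ 2 ∣ j := by
  obtain ⟨r, rfl⟩ : ∃ r, m = 2 * k + 1 + r := ⟨m - (2 * k + 1), by omega⟩
  have e1 : q ^ (2 * (2 * k + 1 + r)) = q ^ (2 * k + 1 + r + 1) * ((q ^ 2) ^ k * q ^ r) := by
    rw [← pow_mul, ← pow_add, ← pow_add]; congr 1; ring
  have hr : 1 ≤ q ^ r := Nat.one_le_pow _ _ (by omega)
  have hK : 2 ≤ (q ^ 2) ^ k := by
    calc 2 ≤ q ^ 2 := by nlinarith
      _ ≤ (q ^ 2) ^ k := Nat.le_self_pow hk0 _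
  have hjlt : j < q ^ (2 * (2 * k + 1 + r)) - 1 := by
    have : q ^ (2 * k + 1 + r + 1) * 2 ≤ q ^ (2 * (2 * k + 1 + r)) := by
      rw [e1]; exact Nat.mul_le_mul le_rfl (by nlinarith)
    omega
  have hilt : i * (q ^ 2) ^ k < q ^ (2 * (2 * k + 1 + r)) - 1 := by
    have h1 : (i + 1) * (q ^ 2) ^ k ≤ q ^ (2 * (2 * k + 1 + r)) := by
      rw [e1]; exact Nat.mul_le_mul hi1 (by nlinarith)
    have h2 : (i + 1) * (q ^ 2) ^ k = i * (q ^ 2) ^ k + (q ^ 2) ^ k := by ring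
    omega
  have := Nat.ModEq.eq_of_lt_of_lt h hilt hjlt
  rw [← this]
  exact Dvd.dvd.mul_left (dvd_pow_self _ hk0) _

lemma mul_pow_modEq_symm {q m i j k : ℕ} (hq : 2 ≤ q) (hk : k ≤ m)
    (h : i * (q ^ 2) ^ k ≡ j [MOD q ^ (2 * m) - 1]) :
    j * (q ^ 2) ^ (m - k) ≡ i [MOD q ^ (2 * m) - 1] := by
  have h1 := (h.mul_right ((q ^ 2) ^ (m - k))).symm
  rw [mul_assoc, ← pow_add, Nat.add_sub_cancel' hk, ← pow_mul q 2 m] at h1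
  refine h1.trans ?_
  have : q ^ (2 * m) ≡ 1 [MOD q ^ (2 * m) - 1] :=
    ((Nat.modEq_iff_dvd' (Nat.one_le_pow _ _ (by omega))).2 dvd_rfl).symm
  simpa using this.mul_left i

/-- Below `q ^ (m + 1)`, the integers not divisible by `q ^ 2` lie in distinct cyclotomic cosets
of full size `m`. -/
lemma eq_zero_of_mul_pow_modEq {q m i j k : ℕ} (hq : 2 ≤ q) (hm : 3 ≤ m) (hmodd : m % 2 = 1)
    (hi1 : i < q ^ (m + 1)) (hj1 : j < q ^ (m + 1)) (hi : ¬ q ^ 2 ∣ i) (hj : ¬ q ^ 2 ∣ j)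
    (hk : k < m) (h : i * (q ^ 2) ^ k ≡ j [MOD q ^ (2 * m) - 1]) : k = 0 := by
  by_contra hk0
  rcases Nat.lt_or_ge m (2 * k + 1) with h1 | h1
  · exact hi (dvd_of_mul_pow_modEq hq hm hj1 hi1 (by omega) (by omega)
      (mul_pow_modEq_symm hq hk.le h))
  · exact hj (dvd_of_mul_pow_modEq hq hm hi1 hj1 hk0 h1 h)

lemma pow_succ_lt_pow_two_mul_sub_one {q m : ℕ} (hq : 2 ≤ q) (hm : 3 ≤ m) :
    q ^ (m + 1) < q ^ (2 * m) - 1 := by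
  have h1 : q ^ (m + 1) * q ^ 2 ≤ q ^ (2 * m) := by
    rw [← pow_add]; exact Nat.pow_le_pow_right (by omega) (by omega)
  have h2 : 1 ≤ q ^ (m + 1) := Nat.one_le_pow _ _ (by omega)
  have h3 : 4 ≤ q ^ 2 := by nlinarith
  have : q ^ (m + 1) * 4 ≤ q ^ (m + 1) * q ^ 2 := Nat.mul_le_mul le_rfl h3
  omega

lemma not_dvd_add_mul_pow_s11 {q m i j r : ℕ} (hq : 2 ≤ q) (hm : 3 ≤ m) (hi0 : 0 < i)
    (hi1 : i < q ^ (m + 1)) (hj1 : j < q ^ (m + 1)) (hr : r + 2 ≤ m) :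
    ¬ q ^ (2 * m) - 1 ∣ i + q ^ r * j := by
  intro h
  have hle := Nat.le_of_dvd (by positivity) h
  have h1 : q ^ r * j ≤ q ^ (m - 2) * (q ^ (m + 1) - 1) :=
    Nat.mul_le_mul (Nat.pow_le_pow_right (by omega) (by omega)) (by omega)
  have h2 : q ^ (m - 2) * (q ^ (m + 1) - 1) = q ^ (2 * m - 1) - q ^ (m - 2) := by
    rw [Nat.mul_sub, ← pow_add, mul_one]; congr 2; omega
  have h3 : q ^ (m + 1) ≤ q ^ (2 * m - 1) := Nat.pow_le_pow_right (by omega) (by omega)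
  have h4 : q ^ (2 * m - 1) * 2 ≤ q ^ (2 * m) := by
    calc q ^ (2 * m - 1) * 2 ≤ q ^ (2 * m - 1) * q := Nat.mul_le_mul le_rfl hq
      _ = q ^ (2 * m) := by rw [← pow_succ]; congr 1; omega
  have h5 : 2 ≤ q ^ (m - 2) := le_trans hq (Nat.le_self_pow (by omega) _)
  have h6 : q ^ (m - 2) ≤ q ^ (2 * m - 1) := Nat.pow_le_pow_right (by omega) (by omega)
  omega

lemma exists_of_dvd_add_mul_pow_self {q m i j : ℕ} (hq : 2 ≤ q) (hm : 3 ≤ m) (hi0 : 0 < i)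
    (hi1 : i < q ^ (m + 1)) (hj1 : j < q ^ (m + 1))
    (h : q ^ (2 * m) - 1 ∣ i + q ^ m * j) :
    ∃ A ∈ Finset.Icc 1 q, ∃ B ∈ Finset.Icc 1 q, i = B * q ^ m - A ∧ j = A * q ^ m - B := by
  obtain ⟨c, hc⟩ := h
  set P := q ^ m with hP
  have e1 : q ^ (m + 1) = q * P := by rw [hP, pow_succ]; ring
  have e2 : q ^ (2 * m) = P * P := by rw [hP, ← pow_add]; congr 1; omega
  have hqP : q ^ 3 ≤ P := Nat.pow_le_pow_right (by omega) hm
  have hqP' : q * 4 ≤ P := le_trans (by nlinarith [pow_succ q 2]) hqP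
  rw [e1] at hi1 hj1
  rw [e2] at hc
  obtain ⟨N, hN⟩ : ∃ N, P * P = N + 1 := ⟨P * P - 1, by
    have : 1 ≤ P * P := by nlinarith
    omega⟩
  rw [hN, Nat.add_sub_cancel] at hc
  have hc0 : 1 ≤ c := by
    rcases Nat.eq_zero_or_pos c with rfl | h
    · simp at hc; omega
    · exact h
  have hcq : c ≤ q := by
    by_contra hcon
    have h1 : N * (q + 1) ≤ N * c := Nat.mul_le_mul le_rfl (by omega)
    have h2 : P * (j + 1) ≤ P * (q * P) := Nat.mul_le_mul le_rfl hj1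
    nlinarith
  obtain ⟨B, hB⟩ : P ∣ i + c := by
    have h1 : i + c + P * j = P * (c * P) := by
      have : P * (c * P) = c * (N + 1) := by rw [← hN]; ring
      rw [this]; linarith [hc, mul_comm N c]
    exact (Nat.dvd_add_left (Dvd.intro _ rfl)).1 (h1 ▸ Dvd.intro _ rfl)
  have hj : B + j = c * P := by
    have : P * (B + j) = P * (c * P) := by
      have : P * (c * P) = c * (N + 1) := by rw [← hN]; ring
      rw [this, mul_add, ← hB]; linarith [hc, mul_comm N c]
    exact Nat.eq_of_mul_eq_mul_left (by omega) this
  have hB0 : 1 ≤ B := by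
    rcases Nat.eq_zero_or_pos B with rfl | h
    · simp at hB; omega
    · exact h
  have hBq : B ≤ q := by
    by_contra hcon
    have : P * (q + 1) ≤ P * B := Nat.mul_le_mul le_rfl (by omega)
    nlinarith
  refine ⟨c, by simp; omega, B, by simp; omega, ?_, by omega⟩
  rw [mul_comm]; omega

/-- The coincidences between the cosets of `i` and of `-q j`. -/
lemma exists_of_dvd_add_mul_pow_s11 {q m i j k : ℕ} (hq : 2 ≤ q) (hm : 3 ≤ m) (hmodd : m % 2 = 1)
    (hi0 : 0 < i) (hj0 : 0 < j)
    (hi1 : i < q ^ (m + 1)) (hj1 : j < q ^ (m + 1)) (hk : k < m)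
    (h : q ^ (2 * m) - 1 ∣ i + q ^ (2 * k + 1) * j) :
    2 * k + 1 = m ∧
    ∃ A ∈ Finset.Icc 1 q, ∃ B ∈ Finset.Icc 1 q, i = B * q ^ m - A ∧ j = A * q ^ m - B := by
  rcases lt_trichotomy (2 * k + 1) m with h1 | h1 | h1
  · exact absurd h (not_dvd_add_mul_pow_s11 hq hm hi0 hi1 hj1 (by omega))
  · rw [h1] at h
    exact ⟨h1, exists_of_dvd_add_mul_pow_self hq hm hi0 hi1 hj1 h⟩
  · refine absurd ?_ (not_dvd_add_mul_pow_s11 (r := 2 * m - (2 * k + 1)) hq hm hj0 hj1 hi1 (by omega))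
    have h2 := h.mul_left (q ^ (2 * m - (2 * k + 1)))
    rw [mul_add, ← mul_assoc, ← pow_add, Nat.sub_add_cancel (by omega)] at h2
    have h3 : q ^ (2 * m) * j = j + (q ^ (2 * m) - 1) * j := by
      have : 1 ≤ q ^ (2 * m) := Nat.one_le_pow _ _ (by omega)
      obtain ⟨N, hN⟩ := Nat.exists_eq_add_of_le this
      rw [hN, Nat.add_sub_cancel_left]; ring
    rw [h3, ← add_assoc] at h2
    rw [add_comm]
    exact (Nat.dvd_add_left (Dvd.intro _ rfl)).1 h2

lemma not_sq_dvd_mul_pow_sub {q m A B : ℕ} (hq : 2 ≤ q) (hm : 3 ≤ m)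
    (hA : A ∈ Finset.Icc 1 q) (hB : B ∈ Finset.Icc 1 q) : ¬ q ^ 2 ∣ B * q ^ m - A := by
  simp only [Finset.mem_Icc] at hA hB
  intro h
  have h1 : q ^ 2 ∣ B * q ^ m := Dvd.dvd.mul_left (pow_dvd_pow _ (by omega)) _
  have hlt : A ≤ B * q ^ m := by
    calc A ≤ q := hA.2
      _ ≤ q ^ m := Nat.le_self_pow (by omega) _
      _ ≤ B * q ^ m := Nat.le_mul_of_pos_left _ hB.1
  have h2 := (Nat.dvd_sub h1 h)
  rw [Nat.sub_sub_self hlt] at h2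
  have := Nat.le_of_dvd hA.1 h2
  nlinarith

lemma dvd_mul_pow_sub_add {q m A B : ℕ} (hq : 2 ≤ q) (hm : 3 ≤ m)
    (hA : A ∈ Finset.Icc 1 q) (hB : B ∈ Finset.Icc 1 q) :
    q ^ (2 * m) - 1 ∣ (B * q ^ m - A) + q ^ m * (A * q ^ m - B) := by
  simp only [Finset.mem_Icc] at hA hB
  have hqm : q ≤ q ^ m := Nat.le_self_pow (by omega) _
  obtain ⟨i, hi⟩ := Nat.exists_eq_add_of_le
    ((hA.2.trans hqm).trans (Nat.le_mul_of_pos_left (q ^ m) hB.1))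
  obtain ⟨j, hj⟩ := Nat.exists_eq_add_of_le
    ((hB.2.trans hqm).trans (Nat.le_mul_of_pos_left (q ^ m) hA.1))
  obtain ⟨N, hN⟩ := Nat.exists_eq_add_of_le (Nat.one_le_pow (2 * m) q (by omega))
  have e2 : q ^ (2 * m) = q ^ m * q ^ m := by rw [← pow_add]; congr 1; omega
  rw [hN, Nat.add_sub_cancel_left, hi, Nat.add_sub_cancel_left, hj, Nat.add_sub_cancel_left]
  refine ⟨A, ?_⟩
  rw [e2] at hN
  have : A * (q ^ m * q ^ m) = A * (1 + N) := by rw [hN]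
  nlinarith

/-- The pairs that parametrize the coincidences below `δ`. -/
def overlapPairs (q m δ : ℕ) : Finset (ℕ × ℕ) :=
  (Finset.Icc 1 q ×ˢ Finset.Icc 1 q).filter
    fun p => p.1 * q ^ m - p.2 ≤ δ - 1 ∧ p.2 * q ^ m - p.1 ≤ δ - 1

lemma mem_overlapPairs {q m δ A B : ℕ} : (A, B) ∈ overlapPairs q m δ ↔
    (A ∈ Finset.Icc 1 q ∧ B ∈ Finset.Icc 1 q) ∧ A * q ^ m - B ≤ δ - 1 ∧ B * q ^ m - A ≤ δ - 1 := by
  simp only [overlapPairs, Finset.mem_filter, Finset.mem_product]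

lemma overlapPairs_eq_product {q m δ u : ℕ} (hq : 2 ≤ q) (hm : 3 ≤ m)
    (hδ : u * q ^ m ≤ δ) (hδ' : u < q → δ ≤ (u + 1) * (q ^ m - 1)) (huq : u ≤ q) (hδ0 : 2 ≤ δ) :
    overlapPairs q m δ = Finset.Icc 1 u ×ˢ Finset.Icc 1 u := by
  have hqm : q + 1 ≤ q ^ m := by
    have : q ^ 3 ≤ q ^ m := Nat.pow_le_pow_right (by omega) hm
    nlinarith [pow_succ q 2]
  obtain ⟨P, hP⟩ : ∃ P, q ^ m = P + 1 := ⟨q ^ m - 1, by omega⟩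
  ext ⟨A, B⟩
  rw [mem_overlapPairs]
  simp only [Finset.mem_product, Finset.mem_Icc]
  rw [hP] at hδ hδ' ⊢
  simp only [Nat.add_sub_cancel] at hδ'
  have key : ∀ A B : ℕ, 1 ≤ A → A ≤ q → 1 ≤ B → B ≤ A → A * (P + 1) - B ≤ δ - 1 → A ≤ u := by
    intro A B h1 h2 h3 h4 h5
    by_contra hcon
    have h6 := hδ' (by omega)
    have h7 : (u + 1) * P ≤ A * P := Nat.mul_le_mul (by omega) le_rfl
    rw [mul_add] at h5
    omega
  have key2 : ∀ A B : ℕ, 1 ≤ B → A ≤ u → A * (P + 1) - B ≤ δ - 1 := by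
    intro A B h1 h2
    have h7 : A * (P + 1) ≤ u * (P + 1) := Nat.mul_le_mul h2 le_rfl
    omega
  constructor
  · rintro ⟨⟨⟨a1, a2⟩, b1, b2⟩, h1, h2⟩
    rcases le_total A B with h | h
    · have := key B A b1 b2 a1 h h2
      omega
    · have := key A B a1 a2 b1 h h1
      omega
  · rintro ⟨⟨a1, a2⟩, b1, b2⟩
    exact ⟨⟨⟨a1, by omega⟩, b1, by omega⟩, key2 A B b1 a2, key2 B A a1 b2⟩

lemma card_overlapPairs_add {q m δ u v : ℕ} (hq : 2 ≤ q) (hm : 3 ≤ m) (hu : 1 ≤ u)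
    (huq : u ≤ q - 1) (hv : v ≤ u - 1) (hδ : δ = (u + 1) * (q ^ m - 1) + v + 1) :
    (overlapPairs q m δ).card = u ^ 2 + 2 * v + 1 := by
  have hqm : q + 1 ≤ q ^ m := by
    have : q ^ 3 ≤ q ^ m := Nat.pow_le_pow_right (by omega) hm
    nlinarith [pow_succ q 2]
  obtain ⟨P, hP⟩ : ∃ P, q ^ m = P + 1 := ⟨q ^ m - 1, by omega⟩
  have hdesc : overlapPairs q m δ =
      ((Finset.Icc 1 u ×ˢ Finset.Icc 1 u) ∪ (({u + 1} : Finset ℕ) ×ˢ Finset.Icc (u + 1 - v) (u + 1)))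
        ∪ (Finset.Icc (u + 1 - v) u ×ˢ ({u + 1} : Finset ℕ)) := by
    ext ⟨A, B⟩
    rw [mem_overlapPairs]
    simp only [Finset.mem_product, Finset.mem_Icc, Finset.mem_union, Finset.mem_singleton]
    rw [hP] at hδ ⊢
    simp only [Nat.add_sub_cancel] at hδ
    have h1 : ∀ A B : ℕ, A ≤ u → 1 ≤ B → A * (P + 1) - B ≤ δ - 1 := by
      intro A B h1 h2
      have h7 : A * (P + 1) ≤ u * (P + 1) := Nat.mul_le_mul h1 le_rfl
      rw [hδ, add_mul]; rw [mul_add u] at h7; omega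
    have h2 : ∀ B : ℕ, B ≤ u + 1 → ((u + 1) * (P + 1) - B ≤ δ - 1 ↔ u + 1 ≤ B + v) := by
      intro B hB
      rw [hδ, mul_add (u + 1)]
      omega
    have h3 : ∀ A B : ℕ, u + 2 ≤ A → B ≤ A → ¬ A * (P + 1) - B ≤ δ - 1 := by
      intro A B h1 h2
      have h7 : (u + 1) * P + P ≤ A * P := by
        calc (u + 1) * P + P = (u + 2) * P := by ring
          _ ≤ A * P := Nat.mul_le_mul h1 le_rfl
      rw [hδ, mul_add A]; omega
    constructor
    · rintro ⟨⟨⟨a1, a2⟩, b1, b2⟩, c1, c2⟩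
      rcases le_total A B with h | h
      · rcases Nat.lt_trichotomy B (u + 1) with h' | rfl | h'
        · left; left; omega
        · have := (h2 A h).1 c2
          omega
        · exact absurd c2 (h3 B A h' h)
      · rcases Nat.lt_trichotomy A (u + 1) with h' | rfl | h'
        · left; left; omega
        · have := (h2 B h).1 c1
          omega
        · exact absurd c1 (h3 A B h' h)
    · rintro ((⟨⟨a1, a2⟩, b1, b2⟩ | ⟨rfl, b1, b2⟩) | ⟨⟨a1, a2⟩, rfl⟩)
      · exact ⟨by omega, h1 _ _ a2 b1, h1 _ _ b2 a1⟩
      · refine ⟨by omega, (h2 _ b2).2 (by omega), ?_⟩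
        rcases Nat.lt_or_ge u B with h | h
        · obtain rfl : B = u + 1 := by omega
          exact (h2 _ le_rfl).2 (by omega)
        · exact h1 _ _ h (by omega)
      · exact ⟨by omega, h1 _ _ a2 (by omega), (h2 _ (by omega)).2 (by omega)⟩
  rw [hdesc, Finset.card_union_of_disjoint, Finset.card_union_of_disjoint]
  · simp only [Finset.card_product, Nat.card_Icc, Finset.card_singleton]
    have : u + 1 + 1 - (u + 1 - v) = v + 1 := by omega
    have h2 : u + 1 - (u + 1 - v) = v := by omega
    rw [this, h2, Nat.add_sub_cancel]; ring
  · rw [Finset.disjoint_left]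
    rintro ⟨A, B⟩
    simp only [Finset.mem_product, Finset.mem_Icc, Finset.mem_singleton]
    omega
  · rw [Finset.disjoint_left]
    rintro ⟨A, B⟩
    simp only [Finset.mem_product, Finset.mem_Icc, Finset.mem_singleton, Finset.mem_union]
    omega

lemma card_filter_not_dvd_Icc (Q d : ℕ) :
    ((Finset.Icc 1 d).filter fun i => ¬ Q ∣ i).card = d - d / Q := by
  have h1 := Finset.card_filter_add_card_filter_not (s := Finset.Icc 1 d) (fun i => Q ∣ i)
  have h2 : ((Finset.Icc 1 d).filter fun i => Q ∣ i).card = d / Q := by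
    rw [← Nat.Ioc_filter_dvd_card_eq_div]; rfl
  rw [Nat.card_Icc] at h1
  omega

lemma lt_card_filter_of_sum_mul_pow_eq_zero {ι E : Type*} [Fintype ι] [DecidableEq ι] [Field E]
    [DecidableEq E] {β f : ι → E} (hβ : Function.Injective β) {t : ℕ}
    (h : ∀ k < t, ∑ i, f i * β i ^ k = 0) (hf : f ≠ 0) :
    t < (Finset.univ.filter fun i => f i ≠ 0).card := by
  by_contra! hcon
  obtain ⟨j, hj⟩ := Function.ne_iff.1 hf
  set S := Finset.univ.filter fun i => f i ≠ 0 with hS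
  have hjS : j ∈ S := by simpa [hS] using hj
  set p : E[X] := ∏ i ∈ S.erase j, (X - C (β i)) with hp
  have hdeg : p.natDegree < t := by
    rw [hp, natDegree_prod_of_monic _ _ fun i _ => monic_X_sub_C _]
    simp only [natDegree_X_sub_C, Finset.sum_const, smul_eq_mul, mul_one]
    exact (Finset.card_erase_lt_of_mem hjS).trans_le hcon
  have h0 : ∑ i, f i * p.eval (β i) = 0 := by
    simp_rw [eval_eq_sum_range' hdeg, Finset.mul_sum]
    rw [Finset.sum_comm]
    refine Finset.sum_eq_zero fun k hk => ?_
    rw [← mul_zero (p.coeff k), ← h k (Finset.mem_range.1 hk), Finset.mul_sum]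
    exact Finset.sum_congr rfl fun i _ => by ring
  rw [Finset.sum_eq_single j] at h0
  · refine (mul_ne_zero hj ?_) h0
    rw [hp, eval_prod, Finset.prod_ne_zero_iff]
    intro i hi
    simpa [sub_eq_zero] using fun e => Finset.ne_of_mem_erase hi (hβ e).symm
  · intro i _ hij
    by_cases hi : f i = 0
    · simp [hi]
    · have : p.eval (β i) = 0 := by
        rw [hp, eval_prod]
        exact Finset.prod_eq_zero (i := i) (by simp [hS, hij, hi]) (by simp)
      simp [this]
  · simp

lemma minpoly_eq_iff_exists_pow {F E : Type*} [Field F] [Fintype F] [Field E] [Finite E]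
    [Algebra F E] {x y : E} :
    minpoly F x = minpoly F y ↔
      ∃ k < Module.finrank F E, y = x ^ Fintype.card F ^ k := by
  rw [eq_comm, Normal.minpoly_eq_iff_mem_orbit, MulAction.mem_orbit_iff]
  constructor
  · rintro ⟨σ, rfl⟩
    obtain ⟨⟨k, hk⟩, rfl⟩ := (FiniteField.bijective_frobeniusAlgEquivOfAlgebraic_pow F E).2 σ
    refine ⟨k, hk, ?_⟩
    simp only [AlgEquiv.smul_def, AlgEquiv.coe_pow,
      FiniteField.coe_frobeniusAlgEquivOfAlgebraic_iterate]
  · rintro ⟨k, -, rfl⟩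
    refine ⟨FiniteField.frobeniusAlgEquivOfAlgebraic F E ^ k, ?_⟩
    simp only [AlgEquiv.smul_def, AlgEquiv.coe_pow,
      FiniteField.coe_frobeniusAlgEquivOfAlgebraic_iterate]

lemma minpoly_pow_card_pow {F E : Type*} [Field F] [Fintype F] [Field E] [Finite E]
    [Algebra F E] (x : E) (k : ℕ) : minpoly F (x ^ Fintype.card F ^ k) = minpoly F x := by
  rw [Normal.minpoly_eq_iff_mem_orbit, MulAction.mem_orbit_iff]
  refine ⟨FiniteField.frobeniusAlgEquivOfAlgebraic F E ^ k, ?_⟩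
  simp only [AlgEquiv.smul_def, AlgEquiv.coe_pow,
    FiniteField.coe_frobeniusAlgEquivOfAlgebraic_iterate]

lemma aeval_minpoly_eq_zero_iff {F E : Type*} [Field F] [Field E] [Finite E]
    [Algebra F E] {x y : E} :
    aeval y (minpoly F x) = 0 ↔ minpoly F x = minpoly F y := by
  refine ⟨fun h => ?_, fun h => h ▸ minpoly.aeval F y⟩
  exact minpoly.eq_of_irreducible_of_monic (minpoly.irreducible (Algebra.IsIntegral.isIntegral x))
    h (minpoly.monic (Algebra.IsIntegral.isIntegral x))

open IntermediateField in
lemma pow_card_pow_natDegree_minpoly {F E : Type*} [Field F] [Fintype F] [Field E] [Finite E]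
    [Algebra F E] (x : E) : x ^ Fintype.card F ^ (minpoly F x).natDegree = x := by
  have hx : IsIntegral F x := Algebra.IsIntegral.isIntegral x
  have : Fintype F⟮x⟯ := Fintype.ofFinite _
  have h := FiniteField.pow_card (AdjoinSimple.gen F x)
  rw [Module.card_eq_pow_finrank (K := F), adjoin.finrank hx] at h
  simpa using congrArg (algebraMap F⟮x⟯ E) h

lemma natDegree_minpoly_eq_one {F E : Type*} [Field F] [Fintype F] [Field E] [Finite E]
    [Algebra F E] {x : E} (h : x ^ Fintype.card F = x) : (minpoly F x).natDegree = 1 := by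
  rw [minpoly.natDegree_eq_one_iff]
  refine (IsGalois.mem_range_algebraMap_iff_fixed x).2 fun σ => ?_
  obtain ⟨⟨k, hk⟩, rfl⟩ := (FiniteField.bijective_frobeniusAlgEquivOfAlgebraic_pow F E).2 σ
  simp only [AlgEquiv.coe_pow, FiniteField.coe_frobeniusAlgEquivOfAlgebraic]
  exact Function.IsFixedPt.iterate h k

/-- A product of distinct monic irreducible polynomials divides whatever its factors divide. -/
lemma prod_dvd_iff_forall_dvd {F : Type*} [Field F] {T : Finset F[X]}
    (hT : ∀ p ∈ T, Irreducible p ∧ p.Monic) {P : F[X]} : ∏ p ∈ T, p ∣ P ↔ ∀ p ∈ T, p ∣ P := by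
  refine ⟨fun h p hp => (Finset.dvd_prod_of_mem _ hp).trans h, fun h => ?_⟩
  refine Finset.prod_dvd_of_coprime (fun p hp p' hp' hne => ?_) h
  refine (hT p hp).1.coprime_iff_not_dvd.2 fun hd => hne ?_
  exact eq_of_monic_of_associated (hT p hp).2 (hT p' hp').2
    ((hT p hp).1.associated_of_dvd (hT p' hp').1 hd)

lemma coeff_polyOfVec {F : Type*} [Field F] {n : ℕ} (c : Fin n → F) (j : Fin n) :
    (polyOfVec c).coeff j = c j := by
  simp [polyOfVec, coeff_X_pow, Fin.val_inj]

lemma polyOfVec_coeff {F : Type*} [Field F] {n : ℕ} {p : F[X]} (hp : p.degree < n) :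
    polyOfVec (fun i : Fin n => p.coeff i) = p := by
  by_cases h0 : p = 0
  · simp [h0, polyOfVec]
  · conv_rhs => rw [p.as_sum_range' n ((natDegree_lt_iff_degree_lt h0).2 hp)]
    rw [polyOfVec, ← Fin.sum_univ_eq_sum_range (fun i => monomial i (p.coeff i))]
    simp only [C_mul_X_pow_eq_monomial]

lemma degree_polyOfVec_lt {F : Type*} [Field F] {n : ℕ} (c : Fin n → F) :
    (polyOfVec c).degree < n := by
  refine mem_degreeLT.1 (Submodule.sum_mem _ fun i _ => mem_degreeLT.2 ?_)
  exact (degree_C_mul_X_pow_le _ _).trans_lt (by exact_mod_cast i.2)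

lemma aeval_polyOfVec {F E : Type*} [Field F] [Field E] [Algebra F E] {n : ℕ} (c : Fin n → F)
    (x : E) : aeval x (polyOfVec c) = ∑ i, algebraMap F E (c i) * x ^ (i : ℕ) := by
  simp [polyOfVec]

lemma finrank_cyclicCodeOf {F : Type*} [Field F] {n : ℕ} {g : F[X]} (hg : g.Monic)
    (hgn : g.natDegree ≤ n) : Module.finrank F (cyclicCodeOf n g) = n - g.natDegree := by
  let L : degreeLT F (n - g.natDegree) →ₗ[F] (Fin n → F) :=
    { toFun := fun p i => (g * p.1).coeff i
      map_add' := fun p p' => by ext i; simp [mul_add]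
      map_smul' := fun r p => by ext i; simp }
  have hdeg : ∀ p : degreeLT F (n - g.natDegree), (g * p.1).degree < n := by
    rintro ⟨p, hp⟩
    rw [mem_degreeLT] at hp
    by_cases h0 : p = 0
    · simp [h0]
    · rw [← natDegree_lt_iff_degree_lt (mul_ne_zero hg.ne_zero h0),
        natDegree_mul hg.ne_zero h0]
      rw [← natDegree_lt_iff_degree_lt h0] at hp
      omega
  have hpoly : ∀ p, polyOfVec (L p) = g * p.1 := fun p => polyOfVec_coeff (hdeg p)
  have hinj : Function.Injective L := by
    intro p p' h
    have := hpoly p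
    rw [h, hpoly p'] at this
    exact Subtype.ext (mul_left_cancel₀ hg.ne_zero this).symm
  have hrange : LinearMap.range L = cyclicCodeOf n g := by
    ext c
    constructor
    · rintro ⟨p, rfl⟩
      exact Dvd.intro _ (hpoly p).symm
    · rintro ⟨p, hp⟩
      have hlt : p ∈ degreeLT F (n - g.natDegree) := by
        rw [mem_degreeLT]
        by_cases h0 : p = 0
        · simp [h0]
        · have h1 := degree_polyOfVec_lt c
          rw [hp, ← natDegree_lt_iff_degree_lt (mul_ne_zero hg.ne_zero h0),
            natDegree_mul hg.ne_zero h0] at h1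
          rw [← natDegree_lt_iff_degree_lt h0]
          omega
      refine ⟨⟨p, hlt⟩, funext fun i => ?_⟩
      rw [← coeff_polyOfVec c i, hp]
      rfl
  rw [← hrange, LinearMap.finrank_range_of_inj hinj, (degreeLTEquiv F _).finrank_eq]
  simp

lemma pow_val_add {M : Type*} [Monoid M] {n : ℕ} [NeZero n] {z : M} (hz : z ^ n = 1)
    (i j : Fin n) : z ^ ((i + j : Fin n) : ℕ) = z ^ (i : ℕ) * z ^ (j : ℕ) := by
  rw [Fin.val_add, ← pow_eq_pow_mod _ hz, pow_add]

lemma aeval_polyOfVec_shift {F E : Type*} [Field F] [Field E] [Algebra F E] {n : ℕ} [NeZero n]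
    (c : Fin n → F) (k : Fin n) {x : E} (hx : x ^ n = 1) :
    aeval x (polyOfVec fun i => c (i - k)) = x ^ (k : ℕ) * aeval x (polyOfVec c) := by
  rw [aeval_polyOfVec, aeval_polyOfVec, Finset.mul_sum, ← Equiv.sum_comp (Equiv.addRight k)]
  refine Finset.sum_congr rfl fun i _ => ?_
  simp only [Equiv.coe_addRight, add_sub_cancel_right, pow_val_add hx]
  ring

lemma sum_pow_of_card_eq_sq {F E : Type*} [Field F] [Fintype F] [Field E] [Algebra F E] {q : ℕ}
    (hq : IsPrimePow q) (hF : Fintype.card F = q ^ 2) {ι : Type*} (s : Finset ι) (f : ι → E) :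
    (∑ i ∈ s, f i) ^ q = ∑ i ∈ s, f i ^ q := by
  obtain ⟨p, k, hp, hk, rfl⟩ := hq
  obtain ⟨p', hchar⟩ := CharP.exists F
  obtain ⟨r, hp', hr⟩ := FiniteField.card F p'
  have hpp : p' = p := by
    have h1 : p' ∣ (p ^ k) ^ 2 := by
      rw [← hF, hr]
      exact dvd_pow_self _ r.ne_zero
    exact (Nat.prime_dvd_prime_iff_eq hp' hp.nat_prime).1
      (hp'.dvd_of_dvd_pow (hp'.dvd_of_dvd_pow h1))
  subst hpp
  have : CharP E p' := charP_of_injective_algebraMap (algebraMap F E).injective p'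
  have : Fact p'.Prime := ⟨hp'⟩
  simpa only [iterateFrobenius_def] using map_sum (iterateFrobenius E p' k) f s

/-- If the zeros of a cyclic code are stable under `x ↦ x ^ (-q)`, the code is Hermitian LCD. -/
lemma isHermitianLCD_cyclicCodeOf {F E : Type*} [Field F] [Fintype F] [Field E] [Fintype E]
    [Algebra F E] {q n : ℕ} [NeZero n] (hq : IsPrimePow q) (hF : Fintype.card F = q ^ 2)
    (hinj : Function.Injective fun x : E => x ^ q) {α : E} (hα : orderOf α = n) {g : F[X]}
    (hgn : ∀ x : E, aeval x g = 0 → x ^ n = 1)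
    (hg : ∀ P : F[X], g ∣ P ↔ ∀ x : E, aeval x g = 0 → aeval x P = 0)
    (hstable : ∀ x : E, aeval x g = 0 → aeval (x ^ q)⁻¹ g = 0) :
    IsHermitianLCD q (cyclicCodeOf n g : Set (Fin n → F)) := by
  classical
  have hn0 : n ≠ 0 := NeZero.ne n
  refine Set.eq_singleton_iff_unique_mem.2
    ⟨⟨(cyclicCodeOf n g).zero_mem, fun c _ => by simp⟩, fun b ⟨hb, hbd⟩ => ?_⟩
  have hshift : ∀ c ∈ cyclicCodeOf n g, ∀ k : Fin n, (fun i => c (i - k)) ∈ cyclicCodeOf n g := by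
    intro c hc k
    refine (hg _).2 fun x hx => ?_
    rw [aeval_polyOfVec_shift c k (hgn x hx), (hg _).1 hc x hx, mul_zero]
  have hprod : ∀ c ∈ cyclicCodeOf n g, ∀ y : E, y ^ n = 1 →
      aeval (y ^ q)⁻¹ (polyOfVec b) * aeval y (polyOfVec c) ^ q = 0 := by
    intro c hc y hy
    have hy0 : y ≠ 0 := by
      rintro rfl
      simp [hn0] at hy
    set z := (y ^ q)⁻¹ with hz
    have hzn : z ^ n = 1 := by rw [hz, inv_pow, ← pow_mul, mul_comm, pow_mul, hy]; simp
    have hrow : ∀ i : Fin n, ∑ k : Fin n, z ^ (k : ℕ) * algebraMap F E (c (i - k)) ^ q =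
        z ^ (i : ℕ) * aeval y (polyOfVec c) ^ q := by
      intro i
      rw [aeval_polyOfVec, sum_pow_of_card_eq_sq hq hF, Finset.mul_sum,
        ← Equiv.sum_comp (Equiv.subLeft i)]
      refine Finset.sum_congr rfl fun j _ => ?_
      have h1 := pow_val_add hzn (i - j) j
      rw [sub_add_cancel] at h1
      have h2 : z ^ (j : ℕ) * (y ^ (j : ℕ)) ^ q = 1 := by
        rw [hz, inv_pow, ← pow_mul, ← pow_mul, mul_comm q]
        exact inv_mul_cancel₀ (pow_ne_zero _ hy0)
      simp only [Equiv.subLeft_apply, sub_sub_cancel]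
      rw [h1, mul_pow]
      linear_combination (-(z ^ ((i - j : Fin n) : ℕ) * algebraMap F E (c j) ^ q)) * h2
    calc aeval z (polyOfVec b) * aeval y (polyOfVec c) ^ q
        = ∑ i : Fin n, ∑ k : Fin n, algebraMap F E (b i) * (z ^ (k : ℕ) * algebraMap F E (c (i - k)) ^ q) := by
          rw [aeval_polyOfVec, Finset.sum_mul]
          refine Finset.sum_congr rfl fun i _ => ?_
          rw [← Finset.mul_sum, hrow, mul_assoc]
      _ = ∑ k : Fin n, z ^ (k : ℕ) * algebraMap F E (∑ i, b i * c (i - k) ^ q) := by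
          rw [Finset.sum_comm]
          refine Finset.sum_congr rfl fun k _ => ?_
          rw [map_sum, Finset.mul_sum]
          refine Finset.sum_congr rfl fun i _ => ?_
          rw [map_mul, map_pow]; ring
      _ = 0 := Finset.sum_eq_zero fun k _ => by rw [hbd _ (hshift c hc k)]; simp
  have hdft : ∀ y : E, y ^ n = 1 → aeval (y ^ q)⁻¹ (polyOfVec b) = 0 := by
    intro y hy
    by_cases hgy : aeval y g = 0
    · exact (hg _).1 hb _ (hstable y hgy)
    · have hdeg : g.degree < n := by
        obtain ⟨h, hgh⟩ := (hg (X ^ n - 1)).2 fun x hx => by simp [hgn x hx]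
        have hne : (X ^ n - 1 : F[X]) ≠ 0 := (monic_X_pow_sub_C 1 hn0).ne_zero
        have hg0 : g ≠ 0 := by rintro rfl; simp at hgy
        have hh0 : h ≠ 0 := by rintro rfl; exact hne (by simpa using hgh)
        rw [← natDegree_lt_iff_degree_lt hg0]
        have hd := congrArg natDegree hgh
        rw [natDegree_mul hg0 hh0] at hd
        have hd' : (X ^ n - 1 : F[X]).natDegree = n := natDegree_X_pow_sub_C (r := 1)
        rw [hd'] at hd
        rcases Nat.eq_zero_or_pos h.natDegree with h0 | h0
        · obtain ⟨a, rfl⟩ := natDegree_eq_zero.1 h0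
          have := congrArg (aeval y) hgh
          simp [hy, hgy] at this
          simp [this] at hh0
        · omega
      have hmem : (fun i : Fin n => g.coeff i) ∈ cyclicCodeOf n g := by
        change g ∣ polyOfVec _
        rw [polyOfVec_coeff hdeg]
      have := hprod _ hmem y hy
      rw [polyOfVec_coeff hdeg] at this
      exact (mul_eq_zero.1 this).resolve_right (pow_ne_zero _ hgy)
  have hα1 : α ^ n = 1 := hα ▸ pow_orderOf_eq_one α
  by_contra hb0
  have hαinj : Function.Injective fun i : Fin n => α ^ (i : ℕ) := fun i j hij =>
    Fin.ext (pow_injOn_Iio_orderOf (by simp [hα]) (by simp [hα]) hij)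
  have hlt := lt_card_filter_of_sum_mul_pow_eq_zero (t := n) (f := fun i => algebraMap F E (b i))
    hαinj (fun k _ => ?_) (fun h => hb0 (funext fun i => by
      simpa using congrFun h i))
  · exact absurd (hlt.trans_le (Finset.card_le_univ _)) (by simp)
  · obtain ⟨y, hy⟩ := (Finite.injective_iff_surjective.1 hinj) (α ^ k)⁻¹
    have hy : y ^ q = (α ^ k)⁻¹ := hy
    have hyn : y ^ n = 1 := by
      apply hinj
      change (y ^ n) ^ q = 1 ^ q
      rw [← pow_mul, mul_comm, pow_mul, hy, inv_pow, ← pow_mul, mul_comm, pow_mul, hα1]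
      simp
    have := hdft y hyn
    rw [hy, inv_inv, aeval_polyOfVec] at this
    rw [← this]
    exact Finset.sum_congr rfl fun i _ => by rw [← pow_mul, ← pow_mul, mul_comm k]

lemma pow_eq_pow_iff_modEq_orderOf {E : Type*} [Field E] {α : E} (hα : α ≠ 0) {a b : ℕ} :
    α ^ a = α ^ b ↔ a ≡ b [MOD orderOf α] := by
  have h := pow_eq_pow_iff_modEq (x := Units.mk0 α hα) (n := a) (m := b)
  rw [← orderOf_units, Units.val_mk0] at h
  rw [← h, Units.ext_iff]
  simp

lemma pow_sq_pow_eq_self {E : Type*} [Field E] {ζ : E} {q : ℕ} (hζ : ζ ^ (q + 1) = 1) (k : ℕ) :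
    ζ ^ (q ^ 2) ^ k = ζ := by
  have h0 : ζ ^ q ^ 2 = ζ := by
    have hζ0 : ζ ≠ 0 := by rintro rfl; simp at hζ
    have h1 : ζ ^ q ^ 2 * ζ ^ (q + 1) = ζ * (ζ ^ (q + 1)) ^ q := by ring
    simpa [hζ] using h1
  induction k with
  | zero => simp
  | succ k ih => rw [pow_succ, pow_mul, ih, h0]

lemma finrank_eq_of_card_eq_pow {F E : Type*} [Field F] [Fintype F] [Field E] [Fintype E]
    [Algebra F E] {m : ℕ} (h : Fintype.card E = Fintype.card F ^ m) : Module.finrank F E = m :=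
  Nat.pow_right_injective (Fintype.one_lt_card (α := F))
    ((Module.card_eq_pow_finrank (K := F) (V := E)).symm.trans h)

lemma pow_injective_of_card_eq {E : Type*} [Field E] [Fintype E] {q m : ℕ} (hm : 1 ≤ m)
    (hE : Fintype.card E = (q ^ 2) ^ m) : Function.Injective fun x : E => x ^ q := by
  intro x y hxy
  have h : ∀ z : E, (z ^ q) ^ q ^ (2 * m - 1) = z := fun z => by
    rw [← pow_mul, ← pow_succ', Nat.sub_add_cancel (by omega), pow_mul q, ← hE,
      FiniteField.pow_card]
  rw [← h x, ← h y]
  exact congrArg (· ^ q ^ (2 * m - 1)) hxy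

section Counting

variable {F E : Type*} [Field F] [Fintype F] [Field E] [Fintype E] [Algebra F E]
  {q m : ℕ} {α ζ : E}

lemma minpoly_mul_pow_eq_iff (hF : Fintype.card F = q ^ 2) (hE : Fintype.card E = (q ^ 2) ^ m)
    (hα : α ≠ 0) (hζ : ζ ^ (q + 1) = 1) {i j : ℕ} :
    minpoly F (ζ * α ^ i) = minpoly F (ζ * α ^ j) ↔
      ∃ k < m, i * (q ^ 2) ^ k ≡ j [MOD orderOf α] := by
  have hζ0 : ζ ≠ 0 := by rintro rfl; simp at hζ
  rw [minpoly_eq_iff_exists_pow, finrank_eq_of_card_eq_pow (hF ▸ hE), hF]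
  refine exists_congr fun k => and_congr_right fun _ => ?_
  rw [mul_pow, pow_sq_pow_eq_self hζ, mul_right_inj' hζ0, ← pow_mul,
    pow_eq_pow_iff_modEq_orderOf hα]
  exact ⟨fun h => h.symm, fun h => h.symm⟩

lemma minpoly_mul_inv_pow_eq_mul_pow_iff (hF : Fintype.card F = q ^ 2)
    (hE : Fintype.card E = (q ^ 2) ^ m) (hα : α ≠ 0) (hζ : ζ ^ (q + 1) = 1) {i j : ℕ} :
    minpoly F (ζ * (α ^ (q * j))⁻¹) = minpoly F (ζ * α ^ i) ↔
      ∃ k < m, orderOf α ∣ i + q ^ (2 * k + 1) * j := by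
  have hζ0 : ζ ≠ 0 := by rintro rfl; simp at hζ
  rw [minpoly_eq_iff_exists_pow, finrank_eq_of_card_eq_pow (hF ▸ hE), hF]
  refine exists_congr fun k => and_congr_right fun _ => ?_
  rw [mul_pow, pow_sq_pow_eq_self hζ, mul_right_inj' hζ0, inv_pow, ← pow_mul,
    ← mul_eq_one_iff_eq_inv₀ (pow_ne_zero _ hα), ← pow_add, orderOf_dvd_iff_pow_eq_one]
  ring_nf

lemma minpoly_mul_pow_eq_of_mul_inv_pow (hF : Fintype.card F = q ^ 2) (hm : 1 ≤ m)
    (hE : Fintype.card E = (q ^ 2) ^ m) (hζ : ζ ^ (q + 1) = 1) {i j : ℕ}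
    (h : minpoly F (ζ * (α ^ (q * i))⁻¹) = minpoly F (ζ * (α ^ (q * j))⁻¹)) :
    minpoly F (ζ * α ^ i) = minpoly F (ζ * α ^ j) := by
  have hζ0 : ζ ≠ 0 := by rintro rfl; simp at hζ
  rw [minpoly_eq_iff_exists_pow, hF] at h ⊢
  obtain ⟨k, hk, h⟩ := h
  refine ⟨k, hk, ?_⟩
  rw [mul_pow, pow_sq_pow_eq_self hζ, mul_right_inj' hζ0] at h ⊢
  rw [inv_pow, inv_inj] at h
  refine pow_injective_of_card_eq hm hE ?_
  change (α ^ j) ^ q = ((α ^ i) ^ (q ^ 2) ^ k) ^ q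
  rw [← pow_mul, mul_comm, h]
  ring

lemma minpoly_mul_pow_sq_mul (hF : Fintype.card F = q ^ 2) (hζ : ζ ^ (q + 1) = 1) (i : ℕ) :
    minpoly F (ζ * α ^ (q ^ 2 * i)) = minpoly F (ζ * α ^ i) := by
  rw [← minpoly_pow_card_pow (ζ * α ^ i) 1, hF, mul_pow, pow_sq_pow_eq_self hζ, pow_one,
    ← pow_mul, mul_comm i]

lemma minpoly_mul_inv_pow_sq_mul (hF : Fintype.card F = q ^ 2) (hζ : ζ ^ (q + 1) = 1) (i : ℕ) :
    minpoly F (ζ * (α ^ (q * (q ^ 2 * i)))⁻¹) = minpoly F (ζ * (α ^ (q * i))⁻¹) := by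
  rw [← minpoly_pow_card_pow (ζ * (α ^ (q * i))⁻¹) 1, hF, mul_pow, pow_sq_pow_eq_self hζ, pow_one,
    inv_pow, ← pow_mul]
  ring_nf

/-- Factors of `Q` can be removed from the indices of a family that is invariant under
multiplication by `Q`. -/
lemma image_Icc_eq_image_filter_not_dvd {β : Type*} [DecidableEq β] {f : ℕ → β} {Q : ℕ}
    (hQ : 2 ≤ Q) (hf : ∀ i, f (Q * i) = f i) (d : ℕ) :
    (Finset.Icc 1 d).image f = ((Finset.Icc 1 d).filter fun i => ¬ Q ∣ i).image f := by
  refine Finset.Subset.antisymm ?_ (Finset.image_subset_image (Finset.filter_subset _ _))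
  rw [Finset.image_subset_iff]
  intro i
  induction i using Nat.strong_induction_on with
  | _ i ih =>
    intro hi
    by_cases hd : Q ∣ i
    · obtain ⟨j, rfl⟩ := hd
      rw [hf]
      rw [Finset.mem_Icc] at hi
      have hj : 0 < j := by
        rcases Nat.eq_zero_or_pos j with rfl | h
        · simp at hi
        · exact h
      have hlt : j < Q * j := by nlinarith
      exact ih j hlt (Finset.mem_Icc.2 ⟨hj, by omega⟩)
    · exact Finset.mem_image_of_mem _ (Finset.mem_filter.2 ⟨hi, hd⟩)

lemma natDegree_minpoly_mul_pow (hq : 2 ≤ q) (hm : 3 ≤ m) (hmodd : m % 2 = 1)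
    (hF : Fintype.card F = q ^ 2) (hE : Fintype.card E = (q ^ 2) ^ m)
    (hα : orderOf α = q ^ (2 * m) - 1) (hα0 : α ≠ 0) (hζ : ζ ^ (q + 1) = 1) {i : ℕ}
    (hi : i < q ^ (m + 1)) (hi' : ¬ q ^ 2 ∣ i) : (minpoly F (ζ * α ^ i)).natDegree = m := by
  have hζ0 : ζ ≠ 0 := by rintro rfl; simp at hζ
  have hint : IsIntegral F (ζ * α ^ i) := Algebra.IsIntegral.isIntegral _
  have hdvd := minpoly.degree_dvd hint
  rw [finrank_eq_of_card_eq_pow (hF ▸ hE)] at hdvd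
  refine (Nat.le_of_dvd (by omega) hdvd).antisymm (not_lt.1 fun hlt => ?_)
  have h := pow_card_pow_natDegree_minpoly (F := F) (ζ * α ^ i)
  rw [hF, mul_pow, pow_sq_pow_eq_self hζ, mul_right_inj' hζ0, ← pow_mul,
    pow_eq_pow_iff_modEq_orderOf hα0, hα] at h
  exact (minpoly.natDegree_pos hint).ne' (eq_zero_of_mul_pow_modEq hq hm hmodd hi hi hi' hi' hlt h)

lemma natDegree_minpoly_mul_inv_pow (hq : 2 ≤ q) (hm : 3 ≤ m) (hmodd : m % 2 = 1)
    (hF : Fintype.card F = q ^ 2) (hE : Fintype.card E = (q ^ 2) ^ m)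
    (hα : orderOf α = q ^ (2 * m) - 1) (hα0 : α ≠ 0) (hζ : ζ ^ (q + 1) = 1) {i : ℕ}
    (hi : i < q ^ (m + 1)) (hi' : ¬ q ^ 2 ∣ i) :
    (minpoly F (ζ * (α ^ (q * i))⁻¹)).natDegree = m := by
  have hζ0 : ζ ≠ 0 := by rintro rfl; simp at hζ
  have hint : IsIntegral F (ζ * (α ^ (q * i))⁻¹) := Algebra.IsIntegral.isIntegral _
  have hdvd := minpoly.degree_dvd hint
  rw [finrank_eq_of_card_eq_pow (hF ▸ hE)] at hdvd
  refine (Nat.le_of_dvd (by omega) hdvd).antisymm (not_lt.1 fun hlt => ?_)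
  have h := pow_card_pow_natDegree_minpoly (F := F) (ζ * (α ^ (q * i))⁻¹)
  rw [hF, mul_pow, pow_sq_pow_eq_self hζ, mul_right_inj' hζ0, inv_pow, inv_inj] at h
  have h' : α ^ (i * (q ^ 2) ^ (minpoly F (ζ * (α ^ (q * i))⁻¹)).natDegree) = α ^ i := by
    refine pow_injective_of_card_eq (by omega) hE ?_
    change (α ^ (i * _)) ^ q = (α ^ i) ^ q
    rw [← pow_mul α i q, mul_comm i q]
    conv_rhs => rw [← h]
    ring
  rw [pow_eq_pow_iff_modEq_orderOf hα0, hα] at h'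
  exact (minpoly.natDegree_pos hint).ne' (eq_zero_of_mul_pow_modEq hq hm hmodd hi hi hi' hi' hlt h')

/-- The degree of the product of the distinct minimal polynomials of `ζ`, `ζ α ^ i` and
`ζ α ^ (-q i)` for `1 ≤ i ≤ δ - 1`. -/
lemma natDegree_prod_minpoly [DecidableEq F[X]] (hq : 2 ≤ q) (hm : 3 ≤ m) (hmodd : m % 2 = 1)
    (hF : Fintype.card F = q ^ 2) (hE : Fintype.card E = (q ^ 2) ^ m)
    (hα : orderOf α = q ^ (2 * m) - 1) (hζ : ζ ^ (q + 1) = 1) {δ : ℕ}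
    (hδ : δ ≤ q ^ (m + 1) + 1) :
    (∏ p ∈ insert (minpoly F ζ) ((Finset.Icc 1 (δ - 1)).image (fun i => minpoly F (ζ * α ^ i)) ∪
        (Finset.Icc 1 (δ - 1)).image fun i => minpoly F (ζ * (α ^ (q * i))⁻¹)), p).natDegree +
      (overlapPairs q m δ).card * m = 1 + 2 * (δ - 1 - (δ - 1) / q ^ 2) * m := by
  have hlt := pow_succ_lt_pow_two_mul_sub_one hq hm
  have hα0 : α ≠ 0 := by
    rintro rfl
    rw [orderOf_zero] at hα
    omega
  have hQ : 2 ≤ q ^ 2 := by nlinarith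
  rw [image_Icc_eq_image_filter_not_dvd hQ (minpoly_mul_pow_sq_mul hF hζ),
    image_Icc_eq_image_filter_not_dvd hQ (minpoly_mul_inv_pow_sq_mul hF hζ)]
  set L := (Finset.Icc 1 (δ - 1)).filter fun i => ¬ q ^ 2 ∣ i with hL
  set f := fun i => minpoly F (ζ * α ^ i) with hf
  set f' := fun i => minpoly F (ζ * (α ^ (q * i))⁻¹) with hf'
  have hL' : ∀ i ∈ L, 0 < i ∧ i < q ^ (m + 1) ∧ ¬ q ^ 2 ∣ i := by
    intro i hi
    simp only [hL, Finset.mem_filter, Finset.mem_Icc] at hi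
    refine ⟨hi.1.1, lt_of_le_of_ne (by omega) ?_, hi.2⟩
    rintro rfl
    exact hi.2 (pow_dvd_pow _ (by omega))
  have hinj : Set.InjOn f L := by
    intro i hi j hj hij
    have hi := hL' i hi
    have hj := hL' j hj
    obtain ⟨k, hk, h⟩ := (minpoly_mul_pow_eq_iff hF hE hα0 hζ).1 hij
    rw [hα] at h
    obtain rfl := eq_zero_of_mul_pow_modEq hq hm hmodd hi.2.1 hj.2.1 hi.2.2 hj.2.2 hk h
    rw [pow_zero, mul_one] at h
    exact Nat.ModEq.eq_of_lt_of_lt h (hi.2.1.trans hlt) (hj.2.1.trans hlt)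
  have hinj' : Set.InjOn f' L := fun i hi j hj hij =>
    hinj hi hj (minpoly_mul_pow_eq_of_mul_inv_pow hF (by omega) hE hζ hij)
  have hdeg : ∀ p ∈ L.image f ∪ L.image f', p.natDegree = m := by
    intro p hp
    rw [Finset.mem_union, Finset.mem_image, Finset.mem_image] at hp
    obtain ⟨i, hi, rfl⟩ | ⟨i, hi, rfl⟩ := hp
    · exact natDegree_minpoly_mul_pow hq hm hmodd hF hE hα hα0 hζ (hL' i hi).2.1 (hL' i hi).2.2
    · exact natDegree_minpoly_mul_inv_pow hq hm hmodd hF hE hα hα0 hζ (hL' i hi).2.1 (hL' i hi).2.2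
  have hdeg0 : (minpoly F ζ).natDegree = 1 :=
    natDegree_minpoly_eq_one (by simpa [hF] using pow_sq_pow_eq_self hζ 1)
  have hnotin : minpoly F ζ ∉ L.image f ∪ L.image f' := fun h => by
    have := hdeg _ h
    omega
  have hinter : L.image f ∩ L.image f' =
      (overlapPairs q m δ).image fun p => f (p.2 * q ^ m - p.1) := by
    ext p
    simp only [Finset.mem_inter, Finset.mem_image]
    constructor
    · rintro ⟨⟨i, hi, rfl⟩, j, hj, hij⟩
      obtain ⟨k, hk, h⟩ := (minpoly_mul_inv_pow_eq_mul_pow_iff hF hE hα0 hζ).1 hij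
      rw [hα] at h
      obtain ⟨-, A, hA, B, hB, rfl, rfl⟩ := exists_of_dvd_add_mul_pow_s11 hq hm hmodd (hL' i hi).1
        (hL' j hj).1 (hL' i hi).2.1 (hL' j hj).2.1 hk h
      refine ⟨(A, B), mem_overlapPairs.2 ⟨⟨hA, hB⟩, ?_, ?_⟩, rfl⟩
      · exact (Finset.mem_Icc.1 (Finset.mem_filter.1 hj).1).2
      · exact (Finset.mem_Icc.1 (Finset.mem_filter.1 hi).1).2
    · rintro ⟨⟨A, B⟩, hAB, rfl⟩
      obtain ⟨⟨hA, hB⟩, h1, h2⟩ := mem_overlapPairs.1 hAB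
      have hpos : ∀ A B, A ∈ Finset.Icc 1 q → B ∈ Finset.Icc 1 q → 1 ≤ B * q ^ m - A := by
        intro A B hA hB
        refine Nat.one_le_iff_ne_zero.2 fun h => not_sq_dvd_mul_pow_sub hq hm hA hB ?_
        rw [h]; exact dvd_zero _
      refine ⟨⟨_, Finset.mem_filter.2 ⟨Finset.mem_Icc.2 ⟨hpos A B hA hB, h2⟩,
        not_sq_dvd_mul_pow_sub hq hm hA hB⟩, rfl⟩, A * q ^ m - B,
        Finset.mem_filter.2 ⟨Finset.mem_Icc.2 ⟨hpos B A hB hA, h1⟩,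
        not_sq_dvd_mul_pow_sub hq hm hB hA⟩, ?_⟩
      refine (minpoly_mul_inv_pow_eq_mul_pow_iff hF hE hα0 hζ).2 ⟨m / 2, by omega, ?_⟩
      rw [show 2 * (m / 2) + 1 = m by omega, hα]
      exact dvd_mul_pow_sub_add hq hm hA hB
  have hcard : (L.image f ∩ L.image f').card = (overlapPairs q m δ).card := by
    rw [hinter, Finset.card_image_of_injOn]
    rintro ⟨A, B⟩ h ⟨A', B'⟩ h' he
    obtain ⟨⟨hA, hB⟩, -, h2⟩ := mem_overlapPairs.1 h
    obtain ⟨⟨hA', hB'⟩, -, h2'⟩ := mem_overlapPairs.1 h'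
    have hmem : ∀ A B, A ∈ Finset.Icc 1 q → B ∈ Finset.Icc 1 q → B * q ^ m - A ≤ δ - 1 →
        B * q ^ m - A ∈ L := by
      intro A B hA hB h2
      refine Finset.mem_filter.2 ⟨Finset.mem_Icc.2 ⟨?_, h2⟩, not_sq_dvd_mul_pow_sub hq hm hA hB⟩
      refine Nat.one_le_iff_ne_zero.2 fun h => not_sq_dvd_mul_pow_sub hq hm hA hB ?_
      rw [h]; exact dvd_zero _
    have heq : B * q ^ m - A = B' * q ^ m - A' := hinj (hmem A B hA hB h2) (hmem A' B' hA' hB' h2') he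
    rw [Finset.mem_Icc] at hA hB hA' hB'
    have hqm : q + 1 ≤ q ^ m := by
      have : q ^ 3 ≤ q ^ m := Nat.pow_le_pow_right (by omega) hm
      nlinarith [pow_succ q 2]
    have hle : ∀ B B' : ℕ, 1 ≤ B → B < B' → B * q ^ m + q ^ m ≤ B' * q ^ m := by
      intro B B' _ hlt
      rw [← Nat.succ_mul]
      exact Nat.mul_le_mul hlt le_rfl
    have hge : ∀ B : ℕ, 1 ≤ B → q ^ m ≤ B * q ^ m := fun B h => Nat.le_mul_of_pos_left _ h
    have := hge B hB.1
    have := hge B' hB'.1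
    rcases Nat.lt_trichotomy B B' with h | rfl | h
    · have := hle B B' hB.1 h
      omega
    · rw [Prod.mk.injEq]
      omega
    · have := hle B' B hB'.1 h
      omega
  have hunion := Finset.card_union_add_card_inter (L.image f) (L.image f')
  rw [hcard, Finset.card_image_of_injOn hinj, Finset.card_image_of_injOn hinj', hL,
    card_filter_not_dvd_Icc, ← hL] at hunion
  rw [natDegree_prod_of_monic, Finset.sum_insert hnotin, hdeg0, Finset.sum_congr rfl hdeg,
    Finset.sum_const, smul_eq_mul, add_assoc, ← add_mul, hunion, two_mul]
  intro p hp
  simp only [Finset.mem_insert, Finset.mem_union, Finset.mem_image] at hp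
  obtain rfl | ⟨i, _, rfl⟩ | ⟨i, _, rfl⟩ := hp <;>
  exact minpoly.monic (Algebra.IsIntegral.isIntegral _)

end Counting

/-- (Theorem on the Hermitian LCD code of length `Qᵐ − 1`, `m` odd.)
The cyclic code with generator polynomial
`g = (x − α^n̂)·g_{(n,δ,n̂+1)}·lcm(m_{n̂−q(δ−1)},…,m_{n̂−q})`, i.e. the lcm (= product of the
distinct values) of the minimal polynomials `m_s` for `s ∈ {n̂} ∪ {n̂+1,…,n̂+δ−1} ∪
{n̂−q(δ−1),…,n̂−q}`, is Hermitian LCD, has minimum distance `≥ δ + 1 + ⌊(δ−1)/q⌋`,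
and has the stated dimension in each case. -/
theorem stmt11 {q Q m e n nh δ : ℕ} (hq : IsPrimePow q) (hQ : Q = q ^ 2) (hm : 2 ≤ m)
    (hmodd : m % 2 = 1) (he : e ∣ q + 1) (he0 : 0 < e) (hn : n = Q ^ m - 1)
    (hnh : nh = n / e) (hδ1 : 2 ≤ δ) (hδ2 : δ ≤ q ^ (m + 1) + 1)
    {F : Type*} [Field F] [Fintype F] [DecidableEq F] (hF : Fintype.card F = Q)
    {E : Type*} [Field E] [Fintype E] [DecidableEq E] [Algebra F E]
    (hE : Fintype.card E = Q ^ m) (α : E) (hα : orderOf α = n)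
    (g : Polynomial F)
    (hg : g = ∏ p ∈ ((insert ((nh : ℤ))
        (((Finset.Icc 1 (δ - 1)).image fun i : ℕ => (nh : ℤ) + i) ∪
          ((Finset.Icc 1 (δ - 1)).image fun i : ℕ => (nh : ℤ) - q * i))).image
            fun s : ℤ => minpoly F (α ^ s)), p) :
    IsHermitianLCD q ((cyclicCodeOf n g : Submodule F (Fin n → F)) : Set (Fin n → F)) ∧
    (∀ c ∈ cyclicCodeOf n g, c ≠ 0 → δ + 1 + (δ - 1) / q ≤ hammingNorm c) ∧
    ((δ ≤ q ^ m - 1 →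
        (Module.finrank F (cyclicCodeOf n g) : ℤ)
          = (Q : ℤ) ^ m - 2 - 2 * ((δ - 1 - (δ - 1) / Q : ℕ) : ℤ) * m) ∧
      (∀ u : ℕ, 1 ≤ u → u ≤ q - 1 → u * q ^ m ≤ δ → δ ≤ (u + 1) * (q ^ m - 1) →
        (Module.finrank F (cyclicCodeOf n g) : ℤ)
          = (Q : ℤ) ^ m - 2 - 2 * ((δ - 1 - (δ - 1) / Q : ℕ) : ℤ) * m + u ^ 2 * m) ∧
      (∀ u v : ℕ, 1 ≤ u → u ≤ q - 1 → v ≤ u - 1 → δ = (u + 1) * (q ^ m - 1) + v + 1 →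
        (Module.finrank F (cyclicCodeOf n g) : ℤ)
          = (Q : ℤ) ^ m - 2 - 2 * ((δ - 1 - (δ - 1) / Q : ℕ) : ℤ) * m
              + (u ^ 2 + 2 * v + 1) * m) ∧
      (δ = q ^ (m + 1) ∨ δ = q ^ (m + 1) + 1 →
        (Module.finrank F (cyclicCodeOf n g) : ℤ)
          = (Q : ℤ) ^ m - 2 - 2 * ((δ - 1 - (δ - 1) / Q : ℕ) : ℤ) * m + q ^ 2 * m)) := by
  classical
  subst hQ
  have hq2 : 2 ≤ q := hq.two_le
  have hm3 : 3 ≤ m := by omega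
  have hnm : n = q ^ (2 * m) - 1 := by rw [hn, ← pow_mul]
  have hlt := pow_succ_lt_pow_two_mul_sub_one hq2 hm3
  have hn0 : n ≠ 0 := by omega
  have : NeZero n := ⟨hn0⟩
  have hα0 : α ≠ 0 := by
    rintro rfl
    rw [orderOf_zero] at hα
    omega
  have hα1 : α ^ n = 1 := hα ▸ pow_orderOf_eq_one α
  have hinj := pow_injective_of_card_eq (q := q) (m := m) (by omega) hE
  obtain ⟨ζ, hζdef⟩ : ∃ ζ, ζ = α ^ nh := ⟨_, rfl⟩
  have hζ : ζ ^ (q + 1) = 1 := by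
    have hqn : q + 1 ∣ n := by
      have h1 : q ^ 2 - 1 ∣ (q ^ 2) ^ m - 1 := by simpa using Nat.sub_dvd_pow_sub_pow (q ^ 2) 1 m
      have h2 : q + 1 ∣ q ^ 2 - 1 := ⟨q - 1, by simpa using Nat.sq_sub_sq q 1⟩
      exact hn ▸ h2.trans h1
    obtain ⟨t, ht⟩ := he
    have h3 : n = e * nh := by rw [hnh, Nat.mul_div_cancel' ((Dvd.intro t ht.symm).trans hqn)]
    rw [hζdef, ht, ← pow_mul, show nh * (e * t) = n * t by rw [h3]; ring, pow_mul, hα1, one_pow]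
  have hζ0 : ζ ≠ 0 := by rintro rfl; simp at hζ
  have hζn : ζ ^ n = 1 := by rw [hζdef, ← pow_mul, mul_comm, pow_mul, hα1, one_pow]
  have hζk := pow_sq_pow_eq_self hζ
  obtain ⟨T, hT⟩ : ∃ T, T = insert (minpoly F ζ)
      ((Finset.Icc 1 (δ - 1)).image (fun i => minpoly F (ζ * α ^ i)) ∪
        (Finset.Icc 1 (δ - 1)).image fun i => minpoly F (ζ * (α ^ (q * i))⁻¹)) := ⟨_, rfl⟩
  have hgT : g = ∏ p ∈ T, p := by
    have hx : ∀ i : ℕ, α ^ ((nh : ℤ) + i) = ζ * α ^ i := fun i => by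
      rw [zpow_add₀ hα0, zpow_natCast, zpow_natCast, hζdef]
    have hy : ∀ i : ℕ, α ^ ((nh : ℤ) - q * i) = ζ * (α ^ (q * i))⁻¹ := fun i => by
      rw [zpow_sub₀ hα0, zpow_natCast, ← Nat.cast_mul, zpow_natCast, hζdef, div_eq_mul_inv]
    rw [hg]
    refine Finset.prod_congr ?_ fun _ _ => rfl
    ext p
    simp only [hT, Finset.image_insert, Finset.image_union, Finset.image_image, Finset.mem_insert,
      Finset.mem_union, Finset.mem_image, Function.comp_apply, hx, hy, zpow_natCast, ← hζdef]
  have hmemT : ∀ p, p ∈ T ↔ p = minpoly F ζ ∨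
      (∃ i ∈ Finset.Icc 1 (δ - 1), minpoly F (ζ * α ^ i) = p) ∨
      ∃ i ∈ Finset.Icc 1 (δ - 1), minpoly F (ζ * (α ^ (q * i))⁻¹) = p := by
    intro p
    simp only [hT, Finset.mem_insert, Finset.mem_union, Finset.mem_image]
  have hTmin : ∀ p ∈ T, ∃ x : E, x ^ n = 1 ∧ minpoly F x = p := by
    intro p hp
    obtain rfl | ⟨i, _, rfl⟩ | ⟨i, _, rfl⟩ := (hmemT p).1 hp
    · exact ⟨_, hζn, rfl⟩
    · refine ⟨_, ?_, rfl⟩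
      rw [mul_pow, hζn, ← pow_mul, mul_comm i, pow_mul, hα1, one_pow, one_mul]
    · refine ⟨_, ?_, rfl⟩
      rw [mul_pow, hζn, inv_pow, ← pow_mul, mul_comm _ n, pow_mul, hα1, one_pow, inv_one, one_mul]
  have hdvd : ∀ P : F[X], g ∣ P ↔ ∀ p ∈ T, p ∣ P := fun P => by
    rw [hgT]
    refine prod_dvd_iff_forall_dvd fun p hp => ?_
    obtain ⟨x, -, rfl⟩ := hTmin p hp
    have hx : IsIntegral F x := Algebra.IsIntegral.isIntegral x
    exact ⟨minpoly.irreducible hx, minpoly.monic hx⟩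
  have hroot : ∀ x : E, aeval x g = 0 ↔ minpoly F x ∈ T := fun x => by
    rw [hgT, map_prod, Finset.prod_eq_zero_iff]
    constructor
    · rintro ⟨p, hp, h⟩
      obtain ⟨y, -, rfl⟩ := hTmin p hp
      rwa [← aeval_minpoly_eq_zero_iff.1 h]
    · exact fun h => ⟨_, h, minpoly.aeval F x⟩
  have hdvd' : ∀ P : F[X], g ∣ P ↔ ∀ x : E, aeval x g = 0 → aeval x P = 0 := fun P => by
    rw [hdvd]
    constructor
    · exact fun h x hx => (minpoly.dvd_iff).1 (h _ ((hroot x).1 hx))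
    · intro h p hp
      obtain ⟨x, -, rfl⟩ := hTmin p hp
      exact minpoly.dvd F x (h x ((hroot x).2 hp))
  have hgX : g ∣ X ^ n - 1 := (hdvd _).2 fun p hp => by
    obtain ⟨x, hx, rfl⟩ := hTmin p hp
    exact minpoly.dvd F x (by simp [hx])
  have hgn : ∀ x : E, aeval x g = 0 → x ^ n = 1 := fun x hx => by
    have := (hdvd' _).1 hgX x hx
    simpa [sub_eq_zero] using this
  have hconj : ∀ x y : E, minpoly F x = minpoly F y → ∃ k, y = x ^ (q ^ 2) ^ k := fun x y h => by
    obtain ⟨k, -, h⟩ := minpoly_eq_iff_exists_pow.1 h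
    exact ⟨k, hF ▸ h⟩
  refine ⟨?_, ?_, ?_⟩
  · refine isHermitianLCD_cyclicCodeOf hq hF hinj hα hgn hdvd' fun x hx => ?_
    have hζq : (ζ ^ q)⁻¹ = ζ := by
      rw [inv_eq_iff_eq_inv, ← mul_eq_one_iff_eq_inv₀ hζ0, ← pow_succ, hζ]
    rw [hroot] at hx ⊢
    obtain h | ⟨i, hi, h⟩ | ⟨i, hi, h⟩ := (hmemT _).1 hx
    · obtain ⟨k, rfl⟩ := hconj _ _ h.symm
      rw [hζk, hζq]
      exact (hmemT _).2 (Or.inl rfl)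
    · obtain ⟨k, rfl⟩ := hconj _ _ h
      refine (hmemT _).2 (Or.inr (Or.inr ⟨i, hi, ?_⟩))
      rw [← minpoly_pow_card_pow _ k, hF, mul_pow, mul_pow, hζk, mul_pow, mul_inv, hζq, inv_pow]
      ring_nf
    · obtain ⟨k, rfl⟩ := hconj _ _ h
      refine (hmemT _).2 (Or.inr (Or.inl ⟨i, hi, ?_⟩))
      rw [← minpoly_pow_card_pow _ (k + 1), hF, mul_pow, mul_pow, hζk, hζk, mul_pow, mul_inv, hζq,
        inv_pow, inv_pow, inv_inv]
      ring_nf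
  · intro c hc hc0
    have hαinj : Function.Injective fun i : Fin n => α ^ (i : ℕ) := fun i j hij =>
      Fin.ext (pow_injOn_Iio_orderOf (by simp [hα]) (by simp [hα]) hij)
    obtain ⟨b, hb⟩ : ∃ b, b = (δ - 1) / q := ⟨_, rfl⟩
    have hz0 : ζ * (α ^ b)⁻¹ ≠ 0 := mul_ne_zero hζ0 (inv_ne_zero (pow_ne_zero _ hα0))
    have hzero : ∀ k < δ + b, aeval (ζ * (α ^ b)⁻¹ * α ^ k) g = 0 := by
      intro k hk
      rw [hroot, hmemT]
      rcases Nat.lt_trichotomy k b with h | rfl | h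
      · obtain ⟨i, rfl⟩ := Nat.exists_eq_add_of_lt h
        refine Or.inr (Or.inr ⟨q * (i + 1), ?_, ?_⟩)
        · have : q * (i + 1) ≤ q * ((δ - 1) / q) := Nat.mul_le_mul le_rfl (by omega)
          rw [Finset.mem_Icc]
          exact ⟨Nat.mul_pos (by omega) (by omega), this.trans (Nat.mul_div_le _ _)⟩
        · have hpow : ζ * (α ^ (k + i + 1))⁻¹ * α ^ k = ζ * (α ^ (i + 1))⁻¹ := by
            field_simp
            ring
          rw [hpow, ← minpoly_pow_card_pow (ζ * (α ^ (i + 1))⁻¹) 1, hF, mul_pow, hζk, inv_pow]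
          ring_nf
      · left
        rw [mul_assoc, inv_mul_cancel₀ (pow_ne_zero _ hα0), mul_one]
      · obtain ⟨i, rfl⟩ := Nat.exists_eq_add_of_lt h
        refine Or.inr (Or.inl ⟨i + 1, Finset.mem_Icc.2 ⟨by omega, by omega⟩, ?_⟩)
        congr 1
        field_simp
        ring
    have hwt := lt_card_filter_of_sum_mul_pow_eq_zero (t := δ + b)
      (f := fun i => algebraMap F E (c i) * (ζ * (α ^ b)⁻¹) ^ (i : ℕ)) hαinj (fun k hk => ?_)
      (fun h => hc0 (funext fun i => ?_))
    · have hnorm : hammingNorm c = (Finset.univ.filter fun i : Fin n =>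
          algebraMap F E (c i) * (ζ * (α ^ b)⁻¹) ^ (i : ℕ) ≠ 0).card := by
        rw [hammingNorm]
        congr 1
        ext i
        have := pow_ne_zero (i : ℕ) hz0
        simp only [Finset.mem_filter, ne_eq, mul_eq_zero, this, or_false, map_eq_zero]
      omega
    · rw [← (hdvd' _).1 hc _ (hzero k hk), aeval_polyOfVec]
      refine Finset.sum_congr rfl fun i _ => ?_
      ring
    · have := congrFun h i
      simpa [pow_ne_zero (i : ℕ) hz0, hζ0, hα0] using this
  · have hmonic : g.Monic := hgT ▸ monic_prod_of_monic _ _ fun p hp => by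
      obtain ⟨x, -, rfl⟩ := hTmin p hp
      exact minpoly.monic (Algebra.IsIntegral.isIntegral x)
    have hdeg := natDegree_prod_minpoly (δ := δ) hq2 hm3 hmodd hF hE (hα.trans hnm) hζ hδ2
    rw [← hT, ← hgT] at hdeg
    have hgle : g.natDegree ≤ n := by
      have := natDegree_le_of_dvd hgX (monic_X_pow_sub_C (1 : F) hn0).ne_zero
      rwa [show (X ^ n - 1 : F[X]).natDegree = n from natDegree_X_pow_sub_C (r := 1)] at this
    have hdim : (Module.finrank F (cyclicCodeOf n g) : ℤ) = ((q ^ 2 : ℕ) : ℤ) ^ m - 2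
        - 2 * ((δ - 1 - (δ - 1) / q ^ 2 : ℕ) : ℤ) * m + (overlapPairs q m δ).card * m := by
      have hpos : 1 ≤ (q ^ 2) ^ m := Nat.one_le_pow _ _ (by positivity)
      have hn' : (n : ℤ) = ((q ^ 2 : ℕ) : ℤ) ^ m - 1 := by rw [hn, Nat.cast_sub hpos]; simp
      rw [finrank_cyclicCodeOf hmonic hgle, Nat.cast_sub hgle, hn']
      have hdeg' := congrArg (Nat.cast : ℕ → ℤ) hdeg
      simp only [Nat.cast_add, Nat.cast_mul, Nat.cast_one, Nat.cast_ofNat] at hdeg'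
      linear_combination -hdeg'
    refine ⟨fun h => ?_, fun u hu huq h1 h2 => ?_, fun u v hu huq hv h => ?_, fun h => ?_⟩ <;>
      rw [hdim]
    · rw [overlapPairs_eq_product (u := 0) hq2 hm3 (by omega) (fun _ => by omega) (by omega) hδ1]
      simp
    · rw [overlapPairs_eq_product (u := u) hq2 hm3 h1 (fun _ => h2) (by omega) hδ1,
        Finset.card_product, Nat.card_Icc, Nat.add_sub_cancel]
      push_cast
      ring
    · rw [card_overlapPairs_add hq2 hm3 hu huq hv h]
      push_cast
      ring
    · rw [overlapPairs_eq_product (u := q) hq2 hm3 (by rw [← pow_succ']; omega)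
        (fun h => absurd h (lt_irrefl _)) le_rfl hδ1, Finset.card_product, Nat.card_Icc,
        Nat.add_sub_cancel]
      push_cast
      ring
end

section
/- Let m ≥ 2 be an even integer and n = (4^m − 1)/3. For any integer i with 1 ≤ i ≤ 2^m and 4 ∤ i: (1) the 4-cyclotomic coset C_i modulo n has cardinality |C_i| = m; (2) i is the coset leader of C_i if and only if i ≠ (2^{m+1} + 1)/3. -/
open Polynomial

/-- In the `4`-cyclotomic coset of `i` modulo `(4 ^ (2 * k) - 1) / 3`, a non-trivial shift of `i`
that does not exceed `i` is the half shift of `(2 * 4 ^ k + 1) / 3`. -/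
theorem shift_le_self {k n i j r : ℕ} (hn : 3 * n + 1 = 4 ^ (2 * k))
    (hi1 : 1 ≤ i) (hi2 : i < 4 ^ k) (hi4 : ¬ 4 ∣ i) (hin : i < n)
    (hj1 : 1 ≤ j) (hj2 : j < 2 * k) (hr : r ≤ i) (h : r ≡ i * 4 ^ j [MOD n]) :
    3 * i = 2 * 4 ^ k + 1 ∧ 3 * r = 4 ^ k + 2 := by
  have hA : 4 ≤ 4 ^ j := by simpa using Nat.pow_le_pow_right (n := 4) (by norm_num) hj1
  have hri : r ≤ i * 4 ^ j := hr.trans (by nlinarith)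
  obtain ⟨q, hq⟩ := (Nat.modEq_iff_dvd' hri).1 h
  have hq : i * 4 ^ j = n * q + r := by omega
  have hqA : q < 4 ^ j := by
    by_contra! hc
    nlinarith [Nat.mul_le_mul_left n hc]
  obtain ⟨t, ht⟩ : ∃ t, 2 * k = j + (t + 1) := ⟨2 * k - j - 1, by omega⟩
  have hAT : 3 * n + 1 = 4 ^ j * 4 ^ (t + 1) := by rw [hn, ht, pow_add]
  have hmain : 4 ^ j * (3 * i) + q = 4 ^ j * (q * 4 ^ (t + 1)) + 3 * r := by
    linear_combination 3 * hq + q * hAT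
  have hle : q * 4 ^ (t + 1) ≤ 3 * i := by
    by_contra! hc
    nlinarith [Nat.mul_le_mul_left (4 ^ j) hc]
  obtain ⟨u, hu⟩ := Nat.exists_eq_add_of_le hle
  have hru : 3 * r = q + 4 ^ j * u := by
    rw [hu] at hmain
    linarith
  have hu1 : 1 ≤ u := by
    by_contra! hc
    obtain rfl : u = 0 := by omega
    rw [pow_succ, ← mul_assoc] at hu
    omega
  have hAk : 4 ^ j < 4 ^ (k + 1) := by
    rw [pow_succ]
    nlinarith
  have hjk : j < k + 1 := (Nat.pow_lt_pow_iff_right (by norm_num)).1 hAk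
  rcases Nat.lt_succ_iff_lt_or_eq.1 hjk with hlt | rfl
  · have hT : 4 ^ (k + 1) ≤ 4 ^ (t + 1) := Nat.pow_le_pow_right (by norm_num) (by omega)
    obtain rfl : q = 0 := by
      by_contra hc
      have := Nat.mul_le_mul (Nat.one_le_iff_ne_zero.2 hc) hT
      rw [pow_succ] at this
      omega
    nlinarith
  · obtain rfl : j = t + 1 := by omega
    set A := 4 ^ (t + 1) with hAdef
    have hmod : A % 3 = 1 := by simp [hAdef, Nat.pow_mod]
    have hq3 : q < 3 := by
      by_contra! hc
      nlinarith [Nat.mul_le_mul_right A hc]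
    have huq : u ≤ q := by
      by_contra! hc
      nlinarith
    have hu3 : u < 3 := by omega
    interval_cases q <;> interval_cases u <;> omega

/-- A `Q`-cyclotomic coset modulo `n` is listed by the exponents below a period of `Q`. -/
theorem cycCoset_eq_image {Q n m s : ℕ} (hn : 0 < n) (hm : 0 < m) (hQ : Q ^ m ≡ 1 [MOD n]) :
    cycCoset Q n (s : ℤ) = (fun j => s * Q ^ j % n) '' Set.Iio m := by
  ext x
  simp only [cycCoset, Set.mem_ofPred_eq, Set.mem_image, Set.mem_Iio]
  constructor
  · rintro ⟨hx, j, hj⟩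
    refine ⟨j % m, Nat.mod_lt _ hm, ?_⟩
    have hj : x ≡ s * Q ^ j [MOD n] := by
      rw [← Int.natCast_modEq_iff]
      exact_mod_cast hj
    have hpow : Q ^ j ≡ Q ^ (j % m) [MOD n] := by
      conv_lhs => rw [← Nat.mod_add_div j m, pow_add, pow_mul]
      simpa using (hQ.pow (j / m)).mul_left (Q ^ (j % m))
    have := hj.trans (hpow.mul_left s)
    rw [Nat.ModEq, Nat.mod_eq_of_lt hx] at this
    exact this.symm
  · rintro ⟨j, -, rfl⟩
    refine ⟨Nat.mod_lt _ hn, j, ?_⟩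
    have := Int.natCast_modEq_iff.2 (Nat.mod_modEq (s * Q ^ j) n)
    exact_mod_cast this


/-- For even `m ≥ 2`, `n = (4ᵐ − 1)/3`, and `1 ≤ i ≤ 2ᵐ` with `4 ∤ i`:
`|C_i| = m`, and `i` is the coset leader of the `4`-cyclotomic coset `C_i` modulo `n`
iff `i ≠ (2^{m+1} + 1)/3`. -/
theorem stmt13 {m i : ℕ} (hm : 2 ≤ m) (hmeven : m % 2 = 0)
    (hi1 : 1 ≤ i) (hi2 : i ≤ 2 ^ m) (hi4 : ¬ (4 ∣ i)) :
    (cycCoset 4 ((4 ^ m - 1) / 3) (i : ℤ)).ncard = m ∧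
    (sInf (cycCoset 4 ((4 ^ m - 1) / 3) (i : ℤ)) = i ↔ i ≠ (2 ^ (m + 1) + 1) / 3) := by
  obtain ⟨k, rfl⟩ : ∃ k, m = 2 * k := ⟨m / 2, by omega⟩
  have hk : 1 ≤ k := by omega
  have hB : 4 ≤ 4 ^ k := by simpa using Nat.pow_le_pow_right (n := 4) (by norm_num) hk
  have hsq : 4 ^ (2 * k) = 4 ^ k * 4 ^ k := by rw [two_mul, pow_add]
  have h2k : 2 ^ (2 * k) = 4 ^ k := by rw [pow_mul]; norm_num
  have hn : 3 * ((4 ^ (2 * k) - 1) / 3) + 1 = 4 ^ (2 * k) := by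
    have : 4 ^ (2 * k) % 3 = 1 := by simp [Nat.pow_mod]
    omega
  generalize (4 ^ (2 * k) - 1) / 3 = n at hn ⊢
  have hi3 : i < 4 ^ k := by
    rw [h2k] at hi2
    refine lt_of_le_of_ne hi2 fun h => hi4 (h ▸ dvd_pow_self 4 (by omega))
  have hin : i < n := by nlinarith
  have hcop : Nat.Coprime n 4 := by
    have hodd : n % 2 = 1 := by
      have : 4 ^ (2 * k) % 2 = 0 := by simp [Nat.pow_mod, show k ≠ 0 by omega]
      omega
    exact (Nat.Coprime.pow_right 2 (Nat.coprime_two_right.2 (Nat.odd_iff.2 hodd)) :)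
  have hper : 4 ^ (2 * k) ≡ 1 [MOD n] := by
    rw [← hn]
    simp [Nat.ModEq]
  have hshift : ∀ j, 1 ≤ j → j < 2 * k → i * 4 ^ j % n ≤ i →
      3 * i = 2 * 4 ^ k + 1 ∧ 3 * (i * 4 ^ j % n) = 4 ^ k + 2 := fun j h1 h2 h3 =>
    shift_le_self hn hi1 hi3 hi4 hin h1 h2 h3 (Nat.mod_modEq _ _)
  have hne : ∀ j, 1 ≤ j → j < 2 * k → i * 4 ^ j % n ≠ i := fun j h1 h2 h3 => by
    have := hshift j h1 h2 h3.le
    omega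
  have hneq : ∀ a b, a < b → b < 2 * k → i * 4 ^ a % n ≠ i * 4 ^ b % n := by
    intro a b hab hb h
    refine hne (b - a) (by omega) (by omega) ?_
    have h : i * 4 ^ a ≡ i * 4 ^ (b - a) * 4 ^ a [MOD n] := by
      rwa [mul_assoc, ← pow_add, Nat.sub_add_cancel hab.le]
    have := Nat.ModEq.cancel_right_of_coprime (Nat.Coprime.pow_right a hcop) h
    rw [Nat.ModEq, Nat.mod_eq_of_lt hin] at this
    exact this.symm
  rw [cycCoset_eq_image (by omega) (by omega) hper]
  have hexc : i ≠ (2 ^ (2 * k + 1) + 1) / 3 ↔ 3 * i ≠ 2 * 4 ^ k + 1 := by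
    have : 4 ^ k % 3 = 1 := by simp [Nat.pow_mod]
    rw [pow_succ, h2k]
    omega
  rw [hexc]
  refine ⟨?_, fun h he => ?_, fun h => ?_⟩
  · rw [Set.InjOn.ncard_image, ← Finset.coe_Iio, Set.ncard_coe_finset, Nat.card_Iio]
    intro a ha b hb hab
    rcases lt_trichotomy a b with h | h | h
    · exact absurd hab (hneq a b h hb)
    · exact h
    · exact absurd hab.symm (hneq b a h ha)
  · obtain ⟨r, hr⟩ : ∃ r, 3 * r = 4 ^ k + 2 := ⟨(4 ^ k + 2) / 3, by omega⟩
    have hr2 : i * 4 ^ k = r + n * 2 := by nlinarith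
    have hmem : r ∈ (fun j => i * 4 ^ j % n) '' Set.Iio (2 * k) := by
      refine ⟨k, by simp; omega, ?_⟩
      simp only [hr2, Nat.add_mul_mod_self_left]
      exact Nat.mod_eq_of_lt (by omega)
    have := Nat.sInf_le hmem
    omega
  · refine IsLeast.csInf_eq ⟨⟨0, by simp; omega, by simpa using Nat.mod_eq_of_lt hin⟩, ?_⟩
    rintro _ ⟨j, hj, rfl⟩
    rcases Nat.eq_zero_or_pos j with rfl | hj0
    · simp [Nat.mod_eq_of_lt hin]
    · by_contra! hc
      exact h (hshift j hj0 hj hc.le).1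
end

section
/- Let m ≥ 5 be an odd integer and n = (4^m − 1)/3. For any integer i with 1 ≤ i ≤ 2^m and 4 ∤ i: (1) the 4-cyclotomic coset C_i modulo n has cardinality |C_i| = m; (2) i is the coset leader of C_i if and only if i ≠ (2^{m+1} + 2)/3 and i ≠ (2^{m+1} + 2^{m−1} + 1)/3. -/
open Polynomial

/-- If `x, y ≤ 2A` with `A = 4 ^ h` and `3n + 1 = 4A²`, a congruence `x * 4 ^ k ≡ y` modulo `n`
with `k ≤ h` is an equality, or exceeds it by exactly one multiple of `n`, at `k = h`. -/
lemma mul_four_pow_eq_or_of_modEq {h n x y k : ℕ} (hh : 2 ≤ h)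
    (hn : 3 * n + 1 = 4 * (4 ^ h * 4 ^ h)) (hx : x ≤ 2 * 4 ^ h) (hy : y ≤ 2 * 4 ^ h)
    (hk : k ≤ h) (hmod : x * 4 ^ k ≡ y [MOD n]) :
    x * 4 ^ k = y ∨ x * 4 ^ h = n + y := by
  have hA : 4 ^ 2 ≤ 4 ^ h := Nat.pow_le_pow_right (by norm_num) hh
  have hyn : y < n := by nlinarith
  rcases hk.lt_or_eq with hlt | rfl
  · left
    have hp : 4 ^ (k + 1) ≤ 4 ^ h := Nat.pow_le_pow_right (by norm_num) hlt
    rw [pow_succ] at hp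
    have hprod : x * (4 ^ k * 4) ≤ 2 * 4 ^ h * 4 ^ h := Nat.mul_le_mul hx hp
    exact hmod.eq_of_lt_of_lt (by nlinarith) hyn
  · by_cases hlt : x * 4 ^ k < n
    · exact Or.inl (hmod.eq_of_lt_of_lt hlt hyn)
    · right
      have hprod : x * 4 ^ k ≤ 2 * 4 ^ k * 4 ^ k := Nat.mul_le_mul_right _ hx
      have hsub : x * 4 ^ k - n ≡ y [MOD n] := by
        refine Nat.ModEq.add_right_cancel' n ?_
        rw [Nat.sub_add_cancel (not_lt.mp hlt)]
        simpa [Nat.ModEq] using hmod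
      have h2n : x * 4 ^ k < 2 * n := by nlinarith
      have := hsub.eq_of_lt_of_lt (by omega) hyn
      omega

/-- The only nontrivial coset relations `i * 4 ^ j ≡ r` with `r ≤ i ≤ 2 ^ m`, `4 ∤ i`,
for `m = 2h + 1` and `n = (4 ^ m - 1) / 3`. -/
lemma eq_or_eq_of_mul_four_pow_modEq {h n i j r : ℕ} (hh : 2 ≤ h)
    (hn : 3 * n + 1 = 4 * (4 ^ h * 4 ^ h)) (hi1 : 1 ≤ i) (hi2 : i ≤ 2 * 4 ^ h)
    (hi4 : ¬ 4 ∣ i) (hj1 : 1 ≤ j) (hj2 : j < 2 * h + 1) (hr : r ≤ i)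
    (hmod : i * 4 ^ j ≡ r [MOD n]) :
    (3 * i = 4 * 4 ^ h + 2 ∧ 3 * r = 2 * 4 ^ h + 1) ∨
      (3 * i = 5 * 4 ^ h + 1 ∧ 3 * r = 4 * 4 ^ h + 5) := by
  have hA : 4 ^ 2 ≤ 4 ^ h := Nat.pow_le_pow_right (by norm_num) hh
  have hA3 : 4 ^ h % 3 = 1 := by simp [Nat.pow_mod]
  rcases le_or_gt j h with hjh | hjh
  · left
    rcases mul_four_pow_eq_or_of_modEq hh hn hi2 (hr.trans hi2) hjh hmod with he | he
    · have : 4 ^ 1 ≤ 4 ^ j := Nat.pow_le_pow_right (by norm_num) hj1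
      nlinarith
    · generalize 4 ^ h = A at *
      have h1 : 4 * A ≤ 3 * i := by
        by_contra! hc
        have : (3 * i + 1) * A ≤ 4 * A * A := Nat.mul_le_mul_right _ hc
        nlinarith
      obtain ⟨d, hd⟩ := Nat.exists_eq_add_of_le h1
      have hrd : 3 * r = d * A + 1 := by nlinarith
      have hd4 : d < 5 := by
        by_contra! hc
        nlinarith
      obtain rfl : d = 2 := by omega
      omega
  · right
    have hpow : r * 4 ^ (2 * h + 1 - j) ≡ i [MOD n] := by
      have h1 := (hmod.mul_right (4 ^ (2 * h + 1 - j))).symm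
      rw [mul_assoc, ← pow_add, Nat.add_sub_cancel' hj2.le] at h1
      refine h1.trans ?_
      have : i * 4 ^ (2 * h + 1) = i + n * (3 * i) := by
        rw [show 4 ^ (2 * h + 1) = 3 * n + 1 by rw [hn]; ring]
        ring
      rw [this]
      simp [Nat.ModEq]
    rcases mul_four_pow_eq_or_of_modEq hh hn (hr.trans hi2) hi2 (by omega) hpow with he | he
    · exact absurd (he ▸ Dvd.dvd.mul_left (dvd_pow_self 4 (by omega)) r) hi4
    · generalize 4 ^ h = A at *
      have h1 : 4 * A ≤ 3 * r := by
        by_contra! hc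
        have : (3 * r + 1) * A ≤ 4 * A * A := Nat.mul_le_mul_right _ hc
        nlinarith
      obtain ⟨s, hs⟩ := Nat.exists_eq_add_of_le h1
      have his : 3 * i = s * A + 1 := by nlinarith
      have hs6 : s < 6 := by
        by_contra! hc
        nlinarith
      obtain rfl | rfl : s = 2 ∨ s = 5 := by omega
      all_goals omega

lemma mem_cycCoset_natCast {Q n s x : ℕ} :
    x ∈ cycCoset Q n (s : ℤ) ↔ x < n ∧ ∃ j : ℕ, s * Q ^ j ≡ x [MOD n] := by
  simp only [cycCoset, Set.mem_ofPred_eq]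
  refine and_congr_right fun _ => exists_congr fun j => ?_
  rw [← Int.natCast_modEq_iff]
  push_cast
  exact Int.modEq_comm

/-- When `Q ^ m ≡ 1` modulo `n`, the coset of `s` consists of the first `m` terms of its orbit. -/
lemma cycCoset_eq_image_range {Q n m s : ℕ} (hn : 0 < n) (hm : 0 < m)
    (hQ : Q ^ m ≡ 1 [MOD n]) :
    cycCoset Q n (s : ℤ) = (fun j => s * Q ^ j % n) '' (Finset.range m : Set ℕ) := by
  ext x
  rw [mem_cycCoset_natCast]
  simp only [Set.mem_image, Finset.coe_range, Set.mem_Iio]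
  constructor
  · rintro ⟨hx, j, hj⟩
    refine ⟨j % m, Nat.mod_lt _ hm, ?_⟩
    have h1 : Q ^ j ≡ Q ^ (j % m) [MOD n] := by
      conv_lhs => rw [← Nat.div_add_mod j m, pow_add, pow_mul]
      simpa using (hQ.pow (j / m)).mul_right (Q ^ (j % m))
    have h2 : s * Q ^ (j % m) % n = x % n := (h1.mul_left s).symm.trans hj
    rw [h2, Nat.mod_eq_of_lt hx]
  · rintro ⟨j, -, rfl⟩
    exact ⟨Nat.mod_lt _ hn, j, (Nat.mod_modEq _ _).symm⟩

/-- For odd `m ≥ 5`, `n = (4ᵐ − 1)/3`, and `1 ≤ i ≤ 2ᵐ` with `4 ∤ i`: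
`|C_i| = m`, and `i` is the coset leader of the `4`-cyclotomic coset `C_i` modulo `n`
iff `i ≠ (2^{m+1} + 2)/3` and `i ≠ (2^{m+1} + 2^{m−1} + 1)/3`. -/
theorem stmt14 {m i : ℕ} (hm : 5 ≤ m) (hmodd : m % 2 = 1)
    (hi1 : 1 ≤ i) (hi2 : i ≤ 2 ^ m) (hi4 : ¬ (4 ∣ i)) :
    (cycCoset 4 ((4 ^ m - 1) / 3) (i : ℤ)).ncard = m ∧
    (sInf (cycCoset 4 ((4 ^ m - 1) / 3) (i : ℤ)) = i ↔
      (i ≠ (2 ^ (m + 1) + 2) / 3 ∧ i ≠ (2 ^ (m + 1) + 2 ^ (m - 1) + 1) / 3)) := by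
  obtain ⟨h, rfl⟩ : ∃ h, m = 2 * h + 1 := ⟨m / 2, by omega⟩
  have hh : 2 ≤ h := by omega
  have hp0 : 4 ^ (2 * h + 1) = 4 * (4 ^ h * 4 ^ h) := by ring
  have hp1 : 2 ^ (2 * h + 1) = 2 * 4 ^ h := by rw [pow_succ, pow_mul]; ring
  have hp2 : 2 ^ (2 * h + 1 + 1) = 4 * 4 ^ h := by rw [pow_succ, hp1]; ring
  have hp3 : 2 ^ (2 * h + 1 - 1) = 4 ^ h := by rw [Nat.add_sub_cancel, pow_mul]; norm_num
  have hA : 4 ^ 2 ≤ 4 ^ h := Nat.pow_le_pow_right (by norm_num) hh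
  have hA3 : 4 ^ h % 3 = 1 := by simp [Nat.pow_mod]
  have hn : 3 * ((4 ^ (2 * h + 1) - 1) / 3) + 1 = 4 * (4 ^ h * 4 ^ h) := by
    have : 4 ^ (2 * h + 1) % 3 = 1 := by simp [Nat.pow_mod]
    omega
  rw [hp2, hp3]
  rw [hp1] at hi2
  generalize (4 ^ (2 * h + 1) - 1) / 3 = n at *
  have hin : i < n := by nlinarith
  have key {j r : ℕ} := eq_or_eq_of_mul_four_pow_modEq (j := j) (r := r) hh hn hi1 hi2 hi4
  have h4 : 4 ^ (2 * h + 1) ≡ 1 [MOD n] := by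
    rw [hp0, ← hn]
    simp [Nat.ModEq]
  have himg := cycCoset_eq_image_range (s := i) (by omega : 0 < n) (by omega) h4
  have hcop : Nat.gcd n 4 = 1 := by
    have : Nat.Coprime n (2 ^ 2) := by
      refine Nat.Coprime.pow_right 2 (Nat.coprime_two_right.mpr ?_)
      rw [Nat.odd_iff]
      omega
    simpa using this
  have hinj : ∀ a b, a < b → b < 2 * h + 1 → i * 4 ^ a % n ≠ i * 4 ^ b % n := by
    intro a b hab hb heq
    have h1 : 4 ^ a * (i * 4 ^ (b - a)) ≡ 4 ^ a * i [MOD n] := by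
      rw [mul_left_comm, ← pow_add, Nat.add_sub_cancel' hab.le, mul_comm (4 ^ a)]
      exact heq.symm
    have h2 := h1.cancel_left_of_coprime (Nat.Coprime.pow_right a hcop)
    have := key (by omega) (by omega) le_rfl h2
    omega
  constructor
  · have : Set.InjOn (fun j => i * 4 ^ j % n) (Finset.range (2 * h + 1) : Set ℕ) := by
      intro a ha b hb heq
      simp only [Finset.coe_range, Set.mem_Iio] at ha hb
      by_contra hne
      rcases Nat.lt_or_gt_of_ne hne with hlt | hlt
      · exact hinj a b hlt hb heq
      · exact hinj b a hlt ha heq.symm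
    rw [himg, this.ncard_image, Set.ncard_coe_finset,
      Finset.card_range]
  · constructor
    · intro hinf
      have hmin : ∀ x < n, ∀ j, i * 4 ^ j ≡ x [MOD n] → i ≤ x := fun x hx j hj =>
        hinf ▸ Nat.sInf_le (mem_cycCoset_natCast.mpr ⟨hx, j, hj⟩)
      constructor
      · intro hi
        obtain ⟨r, hr⟩ : ∃ r, 3 * r = 2 * 4 ^ h + 1 := ⟨(2 * 4 ^ h + 1) / 3, by omega⟩
        have hmul : i * 4 ^ h = r + n * 1 := by
          have : 3 * i = 4 * 4 ^ h + 2 := by omega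
          nlinarith
        have := hmin r (by omega) h (by rw [hmul]; simp [Nat.ModEq])
        omega
      · intro hi
        obtain ⟨r, hr⟩ : ∃ r, 3 * r = 4 * 4 ^ h + 5 := ⟨(4 * 4 ^ h + 5) / 3, by omega⟩
        have hmul : i * 4 ^ (h + 1) = r + n * 5 := by
          have : 3 * i = 5 * 4 ^ h + 1 := by omega
          rw [pow_succ]
          nlinarith
        have := hmin r (by omega) (h + 1) (by rw [hmul]; simp [Nat.ModEq])
        omega
    · rintro ⟨hne1, hne2⟩
      refine IsLeast.csInf_eq ⟨mem_cycCoset_natCast.mpr ⟨hin, 0, by simp [Nat.ModEq]⟩, ?_⟩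
      intro x hx
      rw [himg] at hx
      obtain ⟨j, hj, rfl⟩ := hx
      simp only [Finset.coe_range, Set.mem_Iio] at hj
      by_contra! hlt
      rcases Nat.eq_zero_or_pos j with rfl | hj1
      · simp [Nat.mod_eq_of_lt hin] at hlt
      · have := key hj1 hj hlt.le (Nat.mod_modEq _ _).symm
        omega
end
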